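/- arXiv:2003.02107 — 5 statements merged into one kernel-verified Lean document; each statement's English description precedes it below -/
import Mathlib

section
/- For every natural number k and every natural number N, there exists a strong co-bipartite digraph D with more than N vertices, minimum semidegree δ⁰(D) ≥ k, and no good pair. -/
/-!
Digraphs are modelled by a finite vertex type `V` (with decidable equality) together with
an arc set `A : Finset (V × V)`; irreflexivity (`∀ e ∈ A, e.1 ≠ e.2`) is stated as a
hypothesis.  Subdigraphs on a vertex set `S : Finset V` use arcs with both endpoints in `S`.
-/

variable {V : Type*} [Fintype V] [DecidableEq V]

/-- Reachability by a directed path using arcs of `B`. -/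
def Reach (B : Finset (V × V)) : V → V → Prop :=
  Relation.ReflTransGen (fun u v => (u, v) ∈ B)

/-- `B` is an out-branching, rooted at `q`, of the digraph with vertex set `S`
and arc set `A`: a spanning subdigraph in which every vertex is reachable from `q`
and every vertex other than `q` has in-degree exactly one. -/
def IsOutBranching (S : Finset V) (A B : Finset (V × V)) (q : V) : Prop :=
  q ∈ S ∧ B ⊆ A ∧ (∀ e ∈ B, e.1 ∈ S ∧ e.2 ∈ S) ∧
    (∀ v ∈ S, Reach B q v) ∧
    ∀ v ∈ S, v ≠ q → (B.filter (fun e => e.2 = v)).card = 1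

/-- `B` is an in-branching, rooted at `r`, of the digraph with vertex set `S`
and arc set `A`: a spanning subdigraph in which `r` is reachable from every vertex
and every vertex other than `r` has out-degree exactly one. -/
def IsInBranching (S : Finset V) (A B : Finset (V × V)) (r : V) : Prop :=
  r ∈ S ∧ B ⊆ A ∧ (∀ e ∈ B, e.1 ∈ S ∧ e.2 ∈ S) ∧
    (∀ v ∈ S, Reach B v r) ∧
    ∀ v ∈ S, v ≠ r → (B.filter (fun e => e.1 = v)).card = 1

/-- A good pair: an in-branching and an out-branching sharing no arc. -/
def GoodPair (S : Finset V) (A : Finset (V × V)) : Prop :=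
  ∃ (I O : Finset (V × V)) (r q : V),
    IsInBranching S A I r ∧ IsOutBranching S A O q ∧ Disjoint I O

/-- A good `r`-pair: a good pair whose in-branching is rooted at `r`. -/
def GoodRPair (S : Finset V) (A : Finset (V × V)) (r : V) : Prop :=
  ∃ (I O : Finset (V × V)) (q : V),
    IsInBranching S A I r ∧ IsOutBranching S A O q ∧ Disjoint I O

/-- A good `(r,q)`-pair: in-branching rooted at `r`, out-branching rooted at `q`. -/
def GoodRQPair (S : Finset V) (A : Finset (V × V)) (r q : V) : Prop :=
  ∃ I O : Finset (V × V),
    IsInBranching S A I r ∧ IsOutBranching S A O q ∧ Disjoint I O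

/-- Number of arcs with tail in `X` and head outside `X`. -/
def cutCard (A : Finset (V × V)) (X : Finset V) : ℕ :=
  (A.filter (fun e => e.1 ∈ X ∧ e.2 ∉ X)).card

/-- Arc-connectivity is at least `k`. -/
def ArcConnAtLeast (A : Finset (V × V)) (k : ℕ) : Prop :=
  ∀ X : Finset V, X.Nonempty → X ≠ Finset.univ → k ≤ cutCard A X

/-- Arc-connectivity equals `k`. -/
def ArcConnEq (A : Finset (V × V)) (k : ℕ) : Prop :=
  ArcConnAtLeast A k ∧ ∃ X : Finset V, X.Nonempty ∧ X ≠ Finset.univ ∧ cutCard A X = k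

/-- `S` is an independent set: no two of its vertices are joined by an arc. -/
def IsIndep (A : Finset (V × V)) (S : Finset V) : Prop :=
  ∀ u ∈ S, ∀ v ∈ S, u ≠ v → (u, v) ∉ A ∧ (v, u) ∉ A

/-- The independence number is at most `k`. -/
def IndepNumLE (A : Finset (V × V)) (k : ℕ) : Prop :=
  ∀ S : Finset V, IsIndep A S → S.card ≤ k

/-- The independence number equals `k`. -/
def IndepNumEq (A : Finset (V × V)) (k : ℕ) : Prop :=
  IndepNumLE A k ∧ ∃ S : Finset V, IsIndep A S ∧ S.card = k

/-- The subdigraph induced on `S` is semicomplete. -/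
def SemicompleteOn (S : Finset V) (A : Finset (V × V)) : Prop :=
  ∀ u ∈ S, ∀ v ∈ S, u ≠ v → (u, v) ∈ A ∨ (v, u) ∈ A

/-- The digraph is co-bipartite. -/
def CoBipartite (A : Finset (V × V)) : Prop :=
  ∃ S : Finset V, SemicompleteOn S A ∧ SemicompleteOn Sᶜ A

/-- In-degree of a vertex. -/
def inDeg (A : Finset (V × V)) (v : V) : ℕ := (A.filter (fun e => e.2 = v)).card

/-- Out-degree of a vertex. -/
def outDeg (A : Finset (V × V)) (v : V) : ℕ := (A.filter (fun e => e.1 = v)).card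

/-- Minimum semidegree is at least `k`. -/
def MinSemidegreeGE (A : Finset (V × V)) (k : ℕ) : Prop :=
  ∀ v : V, k ≤ inDeg A v ∧ k ≤ outDeg A v

/-- Reachability by a directed path whose vertices all lie in `T`, using arcs of `A`. -/
def ReachInSet (T : Set V) (A : Finset (V × V)) : V → V → Prop :=
  Relation.ReflTransGen (fun a b => (a, b) ∈ A ∧ a ∈ T ∧ b ∈ T)

theorem Reach.exists_arc_entering {V : Type*} {B : Finset (V × V)} {u v : V}
    (h : Reach B u v) {X : Set V} (hu : u ∉ X) (hv : v ∈ X) :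
    ∃ e ∈ B, e.1 ∉ X ∧ e.2 ∈ X := by
  induction h with
  | refl => exact absurd hv hu
  | @tail b c _ hbc ih =>
    by_cases hb : b ∈ X
    · exact ih hb
    · exact ⟨(b, c), hbc, hb, hv⟩

/-- If `e` is the only arc of `A` entering `X` and the only arc leaving `Y`, then no good pair
has its out-branching rooted outside `X` and its in-branching rooted outside `Y`. -/
theorem not_disjoint_of_unique_arc {V : Type*} [Fintype V] [DecidableEq V]
    {A I O : Finset (V × V)} {r q : V}
    (hI : IsInBranching Finset.univ A I r) (hO : IsOutBranching Finset.univ A O q)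
    (X Y : Set V) (e : V × V) (heX : e.2 ∈ X) (heY : e.1 ∈ Y)
    (hX : ∀ f ∈ A, f.1 ∉ X → f.2 ∈ X → f = e) (hY : ∀ f ∈ A, f.1 ∈ Y → f.2 ∉ Y → f = e)
    (hq : q ∉ X) (hr : r ∉ Y) : ¬ Disjoint I O := by
  intro hd
  obtain ⟨-, hIA, -, hIr, -⟩ := hI
  obtain ⟨-, hOA, -, hOr, -⟩ := hO
  obtain ⟨f, hf, hf1, hf2⟩ := (hOr e.2 (Finset.mem_univ _)).exists_arc_entering hq heX
  obtain ⟨g, hg, hg1, hg2⟩ :=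
    (hIr e.1 (Finset.mem_univ _)).exists_arc_entering (X := Yᶜ) (by simpa using heY) hr
  rw [hX f (hOA hf) hf1 hf2] at hf
  rw [hY g (hIA hg) (by simpa using hg1) hg2] at hg
  exact Finset.disjoint_left.mp hd hg hf

/-- Adjacency of the digraph whose vertices are split into four complete blocks by their residue
mod 4, with all arcs from block 0 to block 1 and from block 2 to block 3, together with the four
further arcs `1 → 0`, `3 → 2`, `0 → 3` and `2 → 1`. -/
def FourBlockAdj (u v : ℕ) : Prop :=
  u ≠ v ∧ (u % 4 = v % 4 ∨ (u % 4 = 0 ∧ v % 4 = 1) ∨ (u % 4 = 2 ∧ v % 4 = 3) ∨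
    (u = 1 ∧ v = 0) ∨ (u = 3 ∧ v = 2) ∨ (u = 0 ∧ v = 3) ∨ (u = 2 ∧ v = 1))

instance (u v : ℕ) : Decidable (FourBlockAdj u v) := by
  unfold FourBlockAdj; infer_instance

/-- The arc set of the four-block digraph with blocks of size `m`. -/
def fourBlockArcs (m : ℕ) : Finset (Fin (4 * m) × Fin (4 * m)) :=
  Finset.univ.filter fun e => FourBlockAdj e.1 e.2

theorem mem_fourBlockArcs {m : ℕ} {e : Fin (4 * m) × Fin (4 * m)} :
    e ∈ fourBlockArcs m ↔ FourBlockAdj e.1 e.2 := by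
  simp [fourBlockArcs]

theorem reach_fourBlockArcs {m : ℕ} (hm : 0 < m) (u v : Fin (4 * m)) :
    Reach (fourBlockArcs m) u v := by
  have step : ∀ a b : Fin (4 * m), a = b ∨ FourBlockAdj a b → Reach (fourBlockArcs m) a b := by
    rintro a b (rfl | h)
    · exact Relation.ReflTransGen.refl
    · exact Relation.ReflTransGen.single (mem_fourBlockArcs.mpr h)
  have toRep : ∀ a b : Fin (4 * m), a.val % 4 = b.val % 4 → Reach (fourBlockArcs m) a b := by
    intro a b h
    refine step a b ?_
    rw [Fin.ext_iff]
    unfold FourBlockAdj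
    omega
  let zero : Fin (4 * m) := ⟨0, by omega⟩
  let one : Fin (4 * m) := ⟨1, by omega⟩
  let two : Fin (4 * m) := ⟨2, by omega⟩
  let three : Fin (4 * m) := ⟨3, by omega⟩
  have h03 : Reach (fourBlockArcs m) zero three :=
    step _ _ (.inr (by simp [FourBlockAdj, zero, three]))
  have h32 : Reach (fourBlockArcs m) three two :=
    step _ _ (.inr (by simp [FourBlockAdj, two, three]))
  have h21 : Reach (fourBlockArcs m) two one :=
    step _ _ (.inr (by simp [FourBlockAdj, two, one]))
  have h10 : Reach (fourBlockArcs m) one zero :=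
    step _ _ (.inr (by simp [FourBlockAdj, zero, one]))
  have hto : ∀ a : Fin (4 * m), Reach (fourBlockArcs m) a zero := by
    intro a
    have : a.val % 4 = 0 ∨ a.val % 4 = 1 ∨ a.val % 4 = 2 ∨ a.val % 4 = 3 := by omega
    rcases this with h | h | h | h
    · exact toRep a zero h
    · exact (toRep a one h).trans h10
    · exact (toRep a two h).trans (h21.trans h10)
    · exact (toRep a three h).trans (h32.trans (h21.trans h10))
  have hfrom : ∀ a : Fin (4 * m), Reach (fourBlockArcs m) zero a := by
    intro a
    have : a.val % 4 = 0 ∨ a.val % 4 = 1 ∨ a.val % 4 = 2 ∨ a.val % 4 = 3 := by omega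
    rcases this with h | h | h | h
    · exact toRep zero a h.symm
    · exact h03.trans (h32.trans (h21.trans (toRep one a h.symm)))
    · exact h03.trans (h32.trans (toRep two a h.symm))
    · exact h03.trans (toRep three a h.symm)
  exact (hto u).trans (hfrom v)

theorem fourBlockAdj_of_mod_le {u v : ℕ} (huv : u ≠ v) (h : u % 4 ≤ v % 4)
    (hside : u % 4 < 2 ↔ v % 4 < 2) : FourBlockAdj u v := by
  refine ⟨huv, ?_⟩
  by_cases hv : v % 4 < 2
  · have : u % 4 = v % 4 ∨ (u % 4 = 0 ∧ v % 4 = 1) := by omega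
    tauto
  · have : u % 4 = v % 4 ∨ (u % 4 = 2 ∧ v % 4 = 3) := by omega
    tauto

theorem coBipartite_fourBlockArcs (m : ℕ) : CoBipartite (fourBlockArcs m) := by
  have adj : ∀ u v : Fin (4 * m), u ≠ v → (u.val % 4 < 2 ↔ v.val % 4 < 2) →
      (u, v) ∈ fourBlockArcs m ∨ (v, u) ∈ fourBlockArcs m := by
    intro u v huv h
    have huv' : u.val ≠ v.val := Fin.val_ne_of_ne huv
    simp only [mem_fourBlockArcs]
    exact (le_total (u.val % 4) (v.val % 4)).imp (fourBlockAdj_of_mod_le huv' · h)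
      (fourBlockAdj_of_mod_le huv'.symm · h.symm)
  refine ⟨Finset.univ.filter fun v => v.val % 4 < 2, fun u hu v hv huv => adj u v huv ?_,
    fun u hu v hv huv => adj u v huv ?_⟩
  · simp only [Finset.mem_filter, Finset.mem_univ, true_and] at hu hv
    exact iff_of_true hu hv
  · simp only [Finset.mem_compl, Finset.mem_filter, Finset.mem_univ, true_and] at hu hv
    exact iff_of_false hu hv

theorem minSemidegreeGE_fourBlockArcs (m : ℕ) : MinSemidegreeGE (fourBlockArcs m) (m - 1) := by
  intro v
  let f : Fin m → Fin (4 * m) := fun j => ⟨4 * j.val + v.val % 4, by omega⟩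
  let J : Finset (Fin m) := Finset.univ.erase ⟨v.val / 4, by omega⟩
  have hJ : J.card = m - 1 := by simp [J]
  have hf : ∀ j ∈ J, (f j).val ≠ v.val ∧ (f j).val % 4 = v.val % 4 := by
    intro j hj
    have hj' : j.val ≠ v.val / 4 := fun h => Finset.ne_of_mem_erase hj (Fin.ext h)
    simp only [f]
    omega
  have hinj : ∀ i j, f i = f j → i = j := by
    intro i j h
    simp only [f, Fin.mk.injEq] at h
    exact Fin.ext (by omega)
  constructor
  · rw [← hJ]
    refine Finset.card_le_card_of_injOn (fun j => (f j, v)) (fun j hj => ?_)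
      (fun i _ j _ h => hinj i j (Prod.ext_iff.mp h).1)
    obtain ⟨h1, h2⟩ := hf j hj
    simpa [mem_fourBlockArcs] using ⟨h1, Or.inl h2⟩
  · rw [← hJ]
    refine Finset.card_le_card_of_injOn (fun j => (v, f j)) (fun j hj => ?_)
      (fun i _ j _ h => hinj i j (Prod.ext_iff.mp h).2)
    obtain ⟨h1, h2⟩ := hf j hj
    simpa [mem_fourBlockArcs] using ⟨h1.symm, Or.inl h2.symm⟩

theorem not_goodPair_fourBlockArcs {m : ℕ} (hm : 0 < m) :
    ¬ GoodPair Finset.univ (fourBlockArcs m) := by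
  rintro ⟨I, O, r, q, hI, hO, hd⟩
  have key := fun X Y e h1 h2 h3 h4 h5 h6 =>
    not_disjoint_of_unique_arc hI hO X Y e h1 h2 h3 h4 h5 h6 hd
  by_cases hq : q.val % 4 < 2 <;> by_cases hr : r.val % 4 < 2
  · refine key {v | v.val % 4 = 2} {v | v.val % 4 = 3} (⟨3, by omega⟩, ⟨2, by omega⟩)
      ?_ ?_ ?_ ?_ ?_ ?_ <;>
    simp only [Set.mem_ofPred_eq, mem_fourBlockArcs, FourBlockAdj, Prod.ext_iff, Fin.ext_iff] <;>
    omega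
  · refine key {v | 2 ≤ v.val % 4} {v | v.val % 4 < 2} (⟨0, by omega⟩, ⟨3, by omega⟩)
      ?_ ?_ ?_ ?_ ?_ ?_ <;>
    simp only [Set.mem_ofPred_eq, mem_fourBlockArcs, FourBlockAdj, Prod.ext_iff, Fin.ext_iff] <;>
    omega
  · refine key {v | v.val % 4 < 2} {v | 2 ≤ v.val % 4} (⟨2, by omega⟩, ⟨1, by omega⟩)
      ?_ ?_ ?_ ?_ ?_ ?_ <;>
    simp only [Set.mem_ofPred_eq, mem_fourBlockArcs, FourBlockAdj, Prod.ext_iff, Fin.ext_iff] <;>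
    omega
  · refine key {v | v.val % 4 = 0} {v | v.val % 4 = 1} (⟨1, by omega⟩, ⟨0, by omega⟩)
      ?_ ?_ ?_ ?_ ?_ ?_ <;>
    simp only [Set.mem_ofPred_eq, mem_fourBlockArcs, FourBlockAdj, Prod.ext_iff, Fin.ext_iff] <;>
    omega

/-- For all `k` and `N` there is a strong co-bipartite digraph on more
than `N` vertices with minimum semidegree at least `k` and no good pair. -/
theorem stmt13 (k N : ℕ) :
    ∃ (n : ℕ) (A : Finset (Fin n × Fin n)),
      N < n ∧ (∀ e ∈ A, e.1 ≠ e.2) ∧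
      (∀ u v : Fin n, Reach A u v) ∧
      CoBipartite A ∧ MinSemidegreeGE A k ∧
      ¬ GoodPair Finset.univ A := by
  refine ⟨4 * (N + k + 1), fourBlockArcs (N + k + 1), by omega, ?_,
    reach_fourBlockArcs (by omega), coBipartite_fourBlockArcs _, ?_,
    not_goodPair_fourBlockArcs (by omega)⟩
  · intro e he h
    exact (mem_fourBlockArcs.mp he).1 (congrArg Fin.val h)
  · intro v
    have := minSemidegreeGE_fourBlockArcs (N + k + 1) v
    omega
end

section
/- For every natural number N there exists a digraph D with more than N vertices such that the arc-connectivity λ(D) equals 2, the independence number α(D) equals 3, and there exist vertices s, t of D for which D has no pair of arc-disjoint branchings consisting of an out-branching rooted at s and an in-branching rooted at t. -/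
/-!
Digraphs are modelled by a finite vertex type `V` (with decidable equality) together with
an arc set `A : Finset (V × V)`; irreflexivity (`∀ e ∈ A, e.1 ≠ e.2`) is stated as a
hypothesis.  Subdigraphs on a vertex set `S : Finset V` use arcs with both endpoints in `S`.
-/

variable {V : Type*} [Fintype V] [DecidableEq V]

/-- The arcs of a 2-arc-strong digraph on five vertices that has no arc-disjoint pair of an
out-branching rooted at `1` and an in-branching rooted at `3`. -/
def coreArcs : Finset (Fin 5 × Fin 5) :=
  {(0, 1), (0, 2), (1, 0), (1, 4), (2, 4), (2, 3), (4, 0), (4, 3), (3, 1), (3, 2)}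

/-- The inclusion of the core into the glued digraph. -/
def coreIncl (N : ℕ) (i : Fin 5) : Fin (N + 7) := Fin.castLE (by omega) i

/-- The contraction of the complete part of the glued digraph onto the vertex `4` of the core. -/
def coreProj (N : ℕ) (v : Fin (N + 7)) : Fin 5 := ⟨min v.val 4, by omega⟩

/-- The core with a complete digraph on `N + 3` vertices glued at the vertex `4`. -/
def gluedArcs (N : ℕ) : Finset (Fin (N + 7) × Fin (N + 7)) :=
  Finset.univ.filter fun e =>
    (∃ c ∈ coreArcs, e = (coreIncl N c.1, coreIncl N c.2)) ∨
      (4 ≤ e.1.val ∧ 4 ≤ e.2.val ∧ e.1 ≠ e.2)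

theorem coreProj_coreIncl (N : ℕ) (i : Fin 5) : coreProj N (coreIncl N i) = i := by
  ext
  simp only [coreProj, coreIncl, Fin.val_castLE]
  omega

theorem coreIncl_injective (N : ℕ) : Function.Injective (coreIncl N) :=
  Function.LeftInverse.injective (coreProj_coreIncl N)

theorem coreIncl_coreProj {N : ℕ} {v : Fin (N + 7)} (hv : v.val ≤ 4) :
    coreIncl N (coreProj N v) = v := by
  ext
  simp only [coreProj, coreIncl, Fin.val_castLE]
  omega

theorem coreProj_eq_four {N : ℕ} {v : Fin (N + 7)} : coreProj N v = 4 ↔ 4 ≤ v.val := by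
  rw [Fin.ext_iff]
  simp only [coreProj]
  change min v.val 4 = 4 ↔ _
  omega

theorem coreIncl_mem_gluedArcs {N : ℕ} {c : Fin 5 × Fin 5} (hc : c ∈ coreArcs) :
    (coreIncl N c.1, coreIncl N c.2) ∈ gluedArcs N := by
  simp only [gluedArcs, Finset.mem_filter, Finset.mem_univ, true_and]
  exact Or.inl ⟨c, hc, rfl⟩

theorem complete_mem_gluedArcs {N : ℕ} {u v : Fin (N + 7)} (hu : 4 ≤ u.val) (hv : 4 ≤ v.val)
    (h : u ≠ v) : (u, v) ∈ gluedArcs N := by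
  simp only [gluedArcs, Finset.mem_filter, Finset.mem_univ, true_and]
  exact Or.inr ⟨hu, hv, h⟩

theorem exists_coreArc_of_mem_gluedArcs {N : ℕ} {u v : Fin (N + 7)} (h : (u, v) ∈ gluedArcs N)
    (hne : coreProj N u ≠ coreProj N v) :
    ∃ c ∈ coreArcs, u = coreIncl N c.1 ∧ v = coreIncl N c.2 := by
  simp only [gluedArcs, Finset.mem_filter, Finset.mem_univ, true_and, Prod.mk.injEq] at h
  rcases h with h | ⟨hu, hv, -⟩
  · exact h
  · exact absurd ((coreProj_eq_four.2 hu).trans (coreProj_eq_four.2 hv).symm) hne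

theorem ne_of_mem_coreArcs : ∀ c ∈ coreArcs, c.1 ≠ c.2 := by decide

theorem ne_of_mem_gluedArcs {N : ℕ} : ∀ e ∈ gluedArcs N, e.1 ≠ e.2 := by
  intro e he
  simp only [gluedArcs, Finset.mem_filter, Finset.mem_univ, true_and] at he
  rcases he with ⟨c, hc, rfl⟩ | ⟨-, -, h⟩
  · exact fun h => ne_of_mem_coreArcs c hc (coreIncl_injective N h)
  · exact h

theorem arcConnAtLeast_coreArcs : ArcConnAtLeast coreArcs 2 := by
  unfold ArcConnAtLeast cutCard
  decide

theorem two_le_cutCard_gluedArcs_of_four_split {N : ℕ} {X : Finset (Fin (N + 7))}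
    {u v : Fin (N + 7)} (hu : 4 ≤ u.val) (hv : 4 ≤ v.val) (huX : u ∈ X) (hvX : v ∉ X) :
    2 ≤ cutCard (gluedArcs N) X := by
  have huv : u ≠ v := by
    rintro rfl
    exact hvX huX
  obtain ⟨w, hw, hwu, hwv⟩ : ∃ w : Fin (N + 7), 4 ≤ w.val ∧ w ≠ u ∧ w ≠ v := by
    by_contra! h
    have h4 := h ⟨4, by omega⟩
    have h5 := h ⟨5, by omega⟩
    have h6 := h ⟨6, by omega⟩
    simp only [ne_eq, Fin.ext_iff] at h4 h5 h6
    omega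
  refine Finset.one_lt_card.2 ⟨(u, v), ?_, ?_⟩
  · simp [complete_mem_gluedArcs hu hv huv, huX, hvX]
  · by_cases hwX : w ∈ X
    · exact ⟨(w, v), by simp [complete_mem_gluedArcs hw hv hwv, hwX, hvX], by simp [hwu.symm]⟩
    · exact ⟨(u, w), by simp [complete_mem_gluedArcs hu hw hwu.symm, hwX, huX],
        by simp [hwv.symm]⟩

theorem arcConnAtLeast_gluedArcs (N : ℕ) : ArcConnAtLeast (gluedArcs N) 2 := by
  intro X hX hX'
  by_cases hsplit : ∃ u v : Fin (N + 7), 4 ≤ u.val ∧ 4 ≤ v.val ∧ u ∈ X ∧ v ∉ X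
  · obtain ⟨u, v, hu, hv, huX, hvX⟩ := hsplit
    exact two_le_cutCard_gluedArcs_of_four_split hu hv huX hvX
  push Not at hsplit
  have hmem : ∀ v, coreIncl N (coreProj N v) ∈ X ↔ v ∈ X := by
    intro v
    by_cases hv : v.val ≤ 4
    · rw [coreIncl_coreProj hv]
    · have h4 : 4 ≤ (coreIncl N (coreProj N v)).val := by
        rw [← coreProj_eq_four, coreProj_coreIncl, coreProj_eq_four]
        omega
      exact ⟨fun h => hsplit _ v h4 (by omega) h, fun h => hsplit v _ (by omega) h4 h⟩
  set Y : Finset (Fin 5) := Finset.univ.filter fun i => coreIncl N i ∈ X with hY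
  have hYne : Y.Nonempty := by
    obtain ⟨v, hv⟩ := hX
    exact ⟨coreProj N v, by simpa [hY] using (hmem v).2 hv⟩
  have hYuniv : Y ≠ Finset.univ := by
    intro h
    refine hX' (Finset.eq_univ_of_forall fun v => (hmem v).1 ?_)
    have := Finset.mem_univ (coreProj N v)
    rw [← h] at this
    simpa [hY] using this
  refine (arcConnAtLeast_coreArcs Y hYne hYuniv).trans ?_
  refine Finset.card_le_card_of_injOn (fun c => (coreIncl N c.1, coreIncl N c.2)) ?_ ?_
  · intro c hc
    simp only [hY, Finset.coe_filter, Finset.mem_filter, Finset.mem_univ, true_and,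
      Set.mem_ofPred_eq] at hc ⊢
    exact ⟨coreIncl_mem_gluedArcs hc.1, hc.2⟩
  · exact ((coreIncl_injective N).prodMap (coreIncl_injective N)).injOn

theorem cutCard_gluedArcs_singleton (N : ℕ) :
    cutCard (gluedArcs N) {coreIncl N 1} = 2 := by
  refine le_antisymm ?_ (arcConnAtLeast_gluedArcs N _ (Finset.singleton_nonempty _) ?_)
  · refine (Finset.card_le_card (t := {(coreIncl N 1, coreIncl N 0),
      (coreIncl N 1, coreIncl N 4)}) ?_).trans Finset.card_le_two
    rintro ⟨u, v⟩ he
    simp only [Finset.mem_filter, Finset.mem_singleton] at he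
    obtain ⟨he, rfl, -⟩ := he
    simp only [gluedArcs, Finset.mem_filter, Finset.mem_univ, true_and, Prod.mk.injEq] at he
    rcases he with ⟨c, hc, h1, rfl⟩ | ⟨h, -⟩
    · have hc2 : ∀ c ∈ coreArcs, 1 = c.1 → c.2 = 0 ∨ c.2 = 4 := by decide
      rcases hc2 c hc (coreIncl_injective N h1) with h | h <;> simp [h]
    · simp [coreIncl] at h
  · intro h
    have : coreIncl N 0 ∈ ({coreIncl N 1} : Finset (Fin (N + 7))) := h ▸ Finset.mem_univ _
    simp [(coreIncl_injective N).eq_iff] at this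

theorem indepNumEq_gluedArcs (N : ℕ) : IndepNumEq (gluedArcs N) 3 := by
  constructor
  · intro S hS
    have hcore : ∀ T : Finset (Fin 5),
        (∀ c ∈ coreArcs, ¬ (c.1 ≠ 4 ∧ c.2 ≠ 4 ∧ c.1 ∈ T ∧ c.2 ∈ T)) → T.card ≤ 3 := by decide
    have hinj : Set.InjOn (coreProj N) S := by
      intro u hu v hv h
      by_contra hne
      by_cases hu4 : 4 ≤ u.val
      · have hv4 : 4 ≤ v.val := coreProj_eq_four.1 (h ▸ coreProj_eq_four.2 hu4)
        exact (hS u hu v hv hne).1 (complete_mem_gluedArcs hu4 hv4 hne)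
      · have hv4 : ¬ 4 ≤ v.val := fun hv4 =>
          hu4 (coreProj_eq_four.1 (h.trans (coreProj_eq_four.2 hv4)))
        apply hne
        rw [← coreIncl_coreProj (v := u) (by omega), h, coreIncl_coreProj (by omega)]
    rw [← Finset.card_image_of_injOn hinj]
    refine hcore _ fun c hc ⟨h1, h2, hc1, hc2⟩ => ?_
    have hlift : ∀ i : Fin 5, i ≠ 4 → i ∈ S.image (coreProj N) → coreIncl N i ∈ S := by
      intro i hi him
      obtain ⟨v, hv, rfl⟩ := Finset.mem_image.1 him
      rw [ne_eq, coreProj_eq_four] at hi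
      rwa [coreIncl_coreProj (by omega)]
    exact (hS _ (hlift _ h1 hc1) _ (hlift _ h2 hc2)
      (fun h => ne_of_mem_coreArcs c hc (coreIncl_injective N h))).1 (coreIncl_mem_gluedArcs hc)
  · let z : Fin (N + 7) := ⟨5, by omega⟩
    have hz : ∀ u v, (u, v) ∈ gluedArcs N → u = z ∨ v = z → 4 ≤ u.val ∧ 4 ≤ v.val := by
      intro u v h huv
      simp only [gluedArcs, Finset.mem_filter, Finset.mem_univ, true_and, Prod.mk.injEq] at h
      rcases h with ⟨c, -, rfl, rfl⟩ | h
      · simp only [z, coreIncl, Fin.ext_iff, Fin.val_castLE] at huv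
        omega
      · exact ⟨h.1, h.2.1⟩
    have hcore : ∀ i j : Fin 5, (coreIncl N i, coreIncl N j) ∈ gluedArcs N → i ≠ j →
        (i, j) ∈ coreArcs := by
      intro i j h hij
      obtain ⟨c, hc, h1, h2⟩ := exists_coreArc_of_mem_gluedArcs h
        (by simpa only [coreProj_coreIncl] using hij)
      rwa [coreIncl_injective N h1, coreIncl_injective N h2]
    have h03 : (coreIncl N 0, coreIncl N 3) ∉ gluedArcs N := fun h =>
      absurd (hcore _ _ h (by decide)) (by decide)
    have h30 : (coreIncl N 3, coreIncl N 0) ∉ gluedArcs N := fun h =>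
      absurd (hcore _ _ h (by decide)) (by decide)
    have hz0 : ∀ i : Fin 5, i.val < 4 →
        (coreIncl N i, z) ∉ gluedArcs N ∧ (z, coreIncl N i) ∉ gluedArcs N := by
      intro i hi
      have hi' : (coreIncl N i).val < 4 := hi
      exact ⟨fun h => by have := hz _ _ h (Or.inr rfl); omega,
        fun h => by have := hz _ _ h (Or.inl rfl); omega⟩
    refine ⟨{coreIncl N 0, coreIncl N 3, z}, ?_, Finset.card_eq_three.2 ⟨_, _, _, ?_, ?_, ?_, rfl⟩⟩
    · have hz0' := hz0 0 (by decide)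
      have hz3' := hz0 3 (by decide)
      intro u hu v hv huv
      simp only [Finset.mem_insert, Finset.mem_singleton] at hu hv
      rcases hu with rfl | rfl | rfl <;> rcases hv with rfl | rfl | rfl <;> tauto
    all_goals simp [z, coreIncl, Fin.ext_iff]

theorem Reach.exists_mem_leaving {W : Type*} {B : Finset (W × W)} {u v : W} (h : Reach B u v)
    (P : W → Prop) (hu : P u) (hv : ¬ P v) : ∃ a b, (a, b) ∈ B ∧ P a ∧ ¬ P b := by
  induction h with
  | refl => exact absurd hu hv
  | @tail a b _ hab ih =>
    by_cases ha : P a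
    · exact ⟨a, b, hab, ha, hv⟩
    · exact ih ha

/-- Branchings of the glued digraph leave each union of fibres of `coreProj` by an arc of the
core. -/
theorem exists_coreArc_leaving {N : ℕ} {B : Finset (Fin (N + 7) × Fin (N + 7))}
    (hB : B ⊆ gluedArcs N) {i j : Fin 5} (h : Reach B (coreIncl N i) (coreIncl N j))
    (C : Finset (Fin 5)) (hi : i ∈ C) (hj : j ∉ C) :
    ∃ c ∈ coreArcs, c.1 ∈ C ∧ c.2 ∉ C ∧ (coreIncl N c.1, coreIncl N c.2) ∈ B := by
  obtain ⟨a, b, hab, ha, hb⟩ := h.exists_mem_leaving (fun v => coreProj N v ∈ C)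
    (by simpa only [coreProj_coreIncl] using hi) (by simpa only [coreProj_coreIncl] using hj)
  obtain ⟨c, hc, rfl, rfl⟩ := exists_coreArc_of_mem_gluedArcs (hB hab) fun h => hb (h ▸ ha)
  simp only [coreProj_coreIncl] at ha hb
  exact ⟨c, hc, ha, hb, hab⟩

theorem no_disjoint_cut_covers_coreArcs (x y : Fin 5 → Fin 5 → Prop)
    (hxy : ∀ i j, x i j → ¬ y i j)
    (hx : ∀ C : Finset (Fin 5), ∀ j, 1 ∈ C → j ∉ C → ∃ c ∈ coreArcs, c.1 ∈ C ∧ c.2 ∉ C ∧ x c.1 c.2)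
    (hy : ∀ C : Finset (Fin 5), ∀ i, i ∈ C → 3 ∉ C → ∃ c ∈ coreArcs, c.1 ∈ C ∧ c.2 ∉ C ∧ y c.1 c.2) :
    False := by
  have y1 := hy {1} 1 (by decide) (by decide)
  have y2 := hy {0, 1} 1 (by decide) (by decide)
  have y3 := hy {2} 2 (by decide) (by decide)
  have y4 := hy {4} 4 (by decide) (by decide)
  have y5 := hy {0, 1, 4} 1 (by decide) (by decide)
  have x1 := hx {0, 1} 2 (by decide) (by decide)
  have x2 := hx {0, 1, 2, 3} 4 (by decide) (by decide)
  have x3 := hx {0, 1, 4} 2 (by decide) (by decide)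
  have x4 := hx {0, 1, 2, 4} 3 (by decide) (by decide)
  have x5 := hx {1, 2, 3, 4} 0 (by decide) (by decide)
  simp [coreArcs] at x1 x2 x3 x4 x5 y1 y2 y3 y4 y5
  grind

/-- For every `N` there is a digraph on more than `N` vertices with
arc-connectivity exactly 2 and independence number exactly 3 having, for some
vertices `s, t`, no arc-disjoint pair of an out-branching rooted at `s` and an
in-branching rooted at `t`. -/
theorem stmt16 (N : ℕ) :
    ∃ (n : ℕ) (A : Finset (Fin n × Fin n)),
      N < n ∧ (∀ e ∈ A, e.1 ≠ e.2) ∧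
      ArcConnEq A 2 ∧ IndepNumEq A 3 ∧
      ∃ s t : Fin n,
        ¬ ∃ O I : Finset (Fin n × Fin n),
            IsOutBranching Finset.univ A O s ∧ IsInBranching Finset.univ A I t ∧
            Disjoint O I := by
  refine ⟨N + 7, gluedArcs N, by omega, ne_of_mem_gluedArcs, ⟨arcConnAtLeast_gluedArcs N,
    {coreIncl N 1}, Finset.singleton_nonempty _, ?_, cutCard_gluedArcs_singleton N⟩,
    indepNumEq_gluedArcs N, coreIncl N 1, coreIncl N 3, ?_⟩
  · intro h
    have : coreIncl N 0 ∈ ({coreIncl N 1} : Finset (Fin (N + 7))) := h ▸ Finset.mem_univ _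
    simp [(coreIncl_injective N).eq_iff] at this
  · rintro ⟨O, I, ⟨-, hOA, -, hO, -⟩, ⟨-, hIA, -, hI, -⟩, hdisj⟩
    exact no_disjoint_cut_covers_coreArcs
      (fun i j => (coreIncl N i, coreIncl N j) ∈ O) (fun i j => (coreIncl N i, coreIncl N j) ∈ I)
      (fun _ _ h => Finset.disjoint_left.1 hdisj h)
      (fun C _ h1 hj => exists_coreArc_leaving hOA (hO _ (Finset.mem_univ _)) C h1 hj)
      (fun C _ hi h3 => exists_coreArc_leaving hIA (hI _ (Finset.mem_univ _)) C hi h3)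
end

section
/- For every natural number N there exists a digraph D with more than N vertices such that the arc-connectivity λ(D) equals 2, the independence number α(D) is at most 7, and D has no good pair. -/
/-!
Digraphs are modelled by a finite vertex type `V` (with decidable equality) together with
an arc set `A : Finset (V × V)`; irreflexivity (`∀ e ∈ A, e.1 ≠ e.2`) is stated as a
hypothesis.  Subdigraphs on a vertex set `S : Finset V` use arcs with both endpoints in `S`.
-/

variable {V : Type*} [Fintype V] [DecidableEq V]

/-- A path leaving a set uses an arc leaving that set. -/
lemma Reach.exists_exit {α : Type*} {B : Finset (α × α)} {u v : α} (h : Reach B u v)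
    {P : α → Prop} (hu : P u) (hv : ¬ P v) : ∃ a b, (a, b) ∈ B ∧ P a ∧ ¬ P b := by
  induction h with
  | refl => exact absurd hu hv
  | @tail b c _ hbc ih =>
    by_cases hb : P b
    · exact ⟨b, c, hbc, hb, hv⟩
    · exact ih hb

namespace BouquetDigraph

/-- The arcs of a gadget on the vertices `0, …, 4` and two hub vertices `5, 6`.  Identifying the
hub vertices gives a 2-arc-strong multidigraph having no arc-disjoint in- and out-branching
that are both rooted at the hub. -/
def gadgetArcs : Finset (Fin 7 × Fin 7) :=
  {(5, 3), (6, 3), (4, 5), (4, 6), (0, 1), (0, 4), (1, 4), (1, 2), (3, 0), (3, 2), (2, 0), (2, 1)}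

/-- Vertices: three disjoint copies of the non-hub gadget vertices, and a hub of size `m + 3`. -/
abbrev Vertex (m : ℕ) : Type := (Fin 3 × Fin 5) ⊕ Fin (m + 3)

/-- The embedding of the gadget as copy number `c`. -/
def embed (m : ℕ) (c : Fin 3) (k : Fin 7) : Vertex m :=
  if h : k.val < 5 then Sum.inl (c, ⟨k, h⟩) else Sum.inr ⟨k.val - 5, by omega⟩

/-- Adjacency in the digraph made of a complete hub and three gadgets attached to it. -/
def Arc (m : ℕ) (x y : Vertex m) : Prop :=
  (∃ i j, i ≠ j ∧ x = Sum.inr i ∧ y = Sum.inr j) ∨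
    ∃ c, ∃ a ∈ gadgetArcs, x = embed m c a.1 ∧ y = embed m c a.2

variable {m : ℕ}

lemma embed_castLE (c : Fin 3) (j : Fin 5) :
    embed m c (j.castLE (by omega)) = Sum.inl (c, j) := by
  simp [embed]

lemma embed_injective (c : Fin 3) : Function.Injective (embed m c) := by
  intro k l h
  unfold embed at h
  split_ifs at h <;> simp [Fin.ext_iff] at h <;> omega

lemma eq_of_embed_eq {c d : Fin 3} {k l : Fin 7} (hk : k.val < 5)
    (h : embed m c k = embed m d l) : c = d ∧ k = l := by
  unfold embed at h
  split_ifs at h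
  simp [Fin.ext_iff] at h
  omega

lemma arc_irrefl (x : Vertex m) : ¬ Arc m x x := by
  rintro (⟨i, j, hij, hi, hj⟩ | ⟨c, a, ha, h1, h2⟩)
  · exact hij (Sum.inr_injective (hi.symm.trans hj))
  · have hne : ∀ a ∈ gadgetArcs, a.1 ≠ a.2 := by decide
    exact hne a ha (embed_injective c (h1.symm.trans h2))

lemma Arc.exists_of_tail {c : Fin 3} {k : Fin 7} (hk : k.val < 5) {y : Vertex m}
    (h : Arc m (embed m c k) y) : ∃ l, (k, l) ∈ gadgetArcs ∧ y = embed m c l := by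
  rcases h with ⟨i, j, -, hi, -⟩ | ⟨d, a, ha, h1, h2⟩
  · simp [embed, hk] at hi
  · obtain ⟨rfl, rfl⟩ := eq_of_embed_eq hk h1
    exact ⟨a.2, ha, h2⟩

lemma Arc.exists_of_head {c : Fin 3} {k : Fin 7} (hk : k.val < 5) {x : Vertex m}
    (h : Arc m x (embed m c k)) : ∃ l, (l, k) ∈ gadgetArcs ∧ x = embed m c l := by
  rcases h with ⟨i, j, -, -, hj⟩ | ⟨d, a, ha, h1, h2⟩
  · simp [embed, hk] at hj
  · obtain ⟨rfl, rfl⟩ := eq_of_embed_eq hk h2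
    exact ⟨a.1, ha, h1⟩

/-- A colouring of the vertices in which every colour class is semicomplete. -/
def color : Vertex m → Fin 7
  | Sum.inl (c, j) => ⟨2 * c + if j = 1 ∨ j = 4 then 1 else 0, by split_ifs <;> omega⟩
  | Sum.inr _ => 6

lemma gadgetArcs_of_color_eq : ∀ (c d : Fin 3) (j k : Fin 5), (c, j) ≠ (d, k) →
    (2 * c.val + if j = 1 ∨ j = 4 then 1 else 0) = (2 * d.val + if k = 1 ∨ k = 4 then 1 else 0) →
    c = d ∧ ((j.castLE (by decide : 5 ≤ 7), k.castLE (by decide : 5 ≤ 7)) ∈ gadgetArcs ∨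
      (k.castLE (by decide : 5 ≤ 7), j.castLE (by decide : 5 ≤ 7)) ∈ gadgetArcs) := by
  decide

lemma arc_of_color_eq {x y : Vertex m} (hxy : x ≠ y) (h : color x = color y) :
    Arc m x y ∨ Arc m y x := by
  rcases x with ⟨c, j⟩ | i <;> rcases y with ⟨d, k⟩ | l
  · obtain ⟨rfl, h | h⟩ := gadgetArcs_of_color_eq c d j k (by simpa using hxy)
      (by simpa [color] using h)
    · exact .inl (.inr ⟨c, _, h, (embed_castLE c j).symm, (embed_castLE c k).symm⟩)
    · exact .inr (.inr ⟨c, _, h, (embed_castLE c k).symm, (embed_castLE c j).symm⟩)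
  · simp only [color, Fin.ext_iff] at h
    split_ifs at h <;> simp at h <;> omega
  · simp only [color, Fin.ext_iff] at h
    split_ifs at h <;> simp at h <;> omega
  · exact .inl (.inl ⟨i, l, by simpa using hxy, rfl, rfl⟩)

set_option maxRecDepth 100000 in
/-- Every cut of the gadget that does not separate the two hub vertices has two arcs. -/
lemma exists_two_gadgetArcs : ∀ T : Fin 7 → Bool, T 5 = T 6 → (∃ j, T j ≠ T 5) →
    ∃ a ∈ gadgetArcs, ∃ b ∈ gadgetArcs, a ≠ b ∧
      (T a.1 = true ∧ T a.2 = false) ∧ T b.1 = true ∧ T b.2 = false := by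
  decide

/-- Every cut of the digraph has two arcs. -/
lemma exists_two_arcs (P : Vertex m → Prop) {u v : Vertex m} (hu : P u) (hv : ¬ P v) :
    ∃ x y x' y', (x, y) ≠ (x', y') ∧ (Arc m x y ∧ P x ∧ ¬ P y) ∧
      Arc m x' y' ∧ P x' ∧ ¬ P y' := by
  classical
  by_cases hK : ∃ i j : Fin (m + 3), P (.inr i) ∧ ¬ P (.inr j)
  · obtain ⟨i, j, hi, hj⟩ := hK
    have hij : i ≠ j := by rintro rfl; exact hj hi
    obtain ⟨k, hk⟩ : ∃ k : Fin (m + 3), k ∉ ({i, j} : Finset _) := by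
      by_contra! h
      have h1 := Finset.card_le_card (fun k _ => h k : Finset.univ ⊆ ({i, j} : Finset _))
      have h2 := Finset.card_le_two (a := i) (b := j)
      simp at h1
      omega
    simp only [Finset.mem_insert, Finset.mem_singleton, not_or] at hk
    by_cases hPk : P (.inr k)
    · exact ⟨_, _, _, _, by simpa using Ne.symm hk.1, ⟨.inl ⟨i, j, hij, rfl, rfl⟩, hi, hj⟩,
        .inl ⟨k, j, hk.2, rfl, rfl⟩, hPk, hj⟩
    · exact ⟨_, _, _, _, by simpa using Ne.symm hk.2, ⟨.inl ⟨i, j, hij, rfl, rfl⟩, hi, hj⟩,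
        .inl ⟨i, k, Ne.symm hk.1, rfl, rfl⟩, hi, hPk⟩
  · have hhub : ∀ i : Fin (m + 3), P (.inr i) ↔ P (.inr 0) := by
      intro i
      push Not at hK
      exact ⟨hK i 0, hK 0 i⟩
    obtain ⟨c, j, hcj⟩ : ∃ c j, ¬ (P (.inl (c, j)) ↔ P (.inr 0)) := by
      by_contra! h
      have hall : ∀ x, P x ↔ P (.inr 0) := by
        rintro (⟨c, j⟩ | i)
        exacts [h c j, hhub i]
      exact hv ((hall v).2 ((hall u).1 hu))
    have h5 : P (embed m c 5) ↔ P (.inr 0) := hhub _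
    have h6 : P (embed m c 6) ↔ P (.inr 0) := hhub _
    obtain ⟨a, ha, b, hb, hab, ⟨ha1, ha2⟩, hb1, hb2⟩ :=
      exists_two_gadgetArcs (fun k => decide (P (embed m c k))) (by simp [h5, h6])
        ⟨j.castLE (by omega), by simpa [embed_castLE, h5] using hcj⟩
    simp only [decide_eq_true_eq, decide_eq_false_iff_not] at ha1 ha2 hb1 hb2
    refine ⟨_, _, _, _, ?_, ⟨.inr ⟨c, a, ha, rfl, rfl⟩, ha1, ha2⟩,
      .inr ⟨c, b, hb, rfl, rfl⟩, hb1, hb2⟩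
    intro h
    rw [Prod.mk.injEq] at h
    exact hab (Prod.ext (embed_injective c h.1) (embed_injective c h.2))

/-- The arcs of the gadget avoiding the hub cannot be split so that every set of vertices keeps
both an exit towards the hub and an entry from the hub. -/
lemma gadget_obstruction (I O : Fin 7 → Fin 7 → Prop) (hdisj : ∀ k l, I k l → ¬ O k l)
    (hI : ∀ T : Finset (Fin 7), T.Nonempty → (∀ k ∈ T, k.val < 5) →
      ∃ k ∈ T, ∃ l ∉ T, (k, l) ∈ gadgetArcs ∧ I k l)
    (hO : ∀ T : Finset (Fin 7), T.Nonempty → (∀ k ∈ T, k.val < 5) →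
      ∃ k ∉ T, ∃ l ∈ T, (k, l) ∈ gadgetArcs ∧ O k l) : False := by
  have i0 := hI {0} (by decide) (by decide)
  have i1 := hI {1} (by decide) (by decide)
  have i2 := hI {2} (by decide) (by decide)
  have i3 := hI {3} (by decide) (by decide)
  have i12 := hI {1, 2} (by decide) (by decide)
  have o0 := hO {0} (by decide) (by decide)
  have o1 := hO {1} (by decide) (by decide)
  have o2 := hO {2} (by decide) (by decide)
  have o4 := hO {4} (by decide) (by decide)
  have o12 := hO {1, 2} (by decide) (by decide)
  simp [gadgetArcs, Fin.exists_fin_succ] at i0 i1 i2 i3 i12 o0 o1 o2 o4 o12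
  grind

end BouquetDigraph

open BouquetDigraph

/-- For every `N` there is a digraph on more than `N` vertices with
arc-connectivity exactly 2 and independence number at most 7 that has no good pair. -/
theorem stmt17 (N : ℕ) :
    ∃ (n : ℕ) (A : Finset (Fin n × Fin n)),
      N < n ∧ (∀ e ∈ A, e.1 ≠ e.2) ∧
      ArcConnEq A 2 ∧ IndepNumLE A 7 ∧
      ¬ GoodPair Finset.univ A := by
  classical
  let e : Fin (Fintype.card (Vertex N)) ≃ Vertex N := (Fintype.equivFin (Vertex N)).symm
  let A : Finset (Fin (Fintype.card (Vertex N)) × Fin (Fintype.card (Vertex N))) :=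
    Finset.univ.filter (fun a => Arc N (e a.1) (e a.2))
  have hA : ∀ x y, (x, y) ∈ A ↔ Arc N (e x) (e y) := by simp [A]
  refine ⟨_, A, ?_, ?_, ⟨?_, ?_⟩, ?_, ?_⟩
  · simp
    omega
  · rintro ⟨x, y⟩ hxy (rfl : x = y)
    exact arc_irrefl _ ((hA _ _).1 hxy)
  · rintro X ⟨u, hu⟩ hX
    obtain ⟨v, hv⟩ : ∃ v, v ∉ X := by
      by_contra! h
      exact hX (Finset.eq_univ_of_forall h)
    obtain ⟨x, y, x', y', hne, ⟨h1, h2, h3⟩, h4, h5, h6⟩ :=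
      exists_two_arcs (fun w => e.symm w ∈ X) (u := e u) (v := e v) (by simpa) (by simpa)
    refine Finset.one_lt_card.2 ⟨(e.symm x, e.symm y), ?_, (e.symm x', e.symm y'), ?_, ?_⟩
    · simp [hA, h1, h2, h3]
    · simp [hA, h4, h5, h6]
    · simpa using hne
  · refine ⟨{e.symm (embed N 0 0)}, by simp, ?_, ?_⟩
    · intro h
      have h1 := Finset.mem_univ (e.symm (embed N 0 1))
      rw [← h, Finset.mem_singleton] at h1
      exact absurd (embed_injective 0 (e.symm.injective h1)) (by decide)
    · have hcut : A.filter (fun a => a.1 ∈ ({e.symm (embed N 0 0)} : Finset _) ∧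
          a.2 ∉ ({e.symm (embed N 0 0)} : Finset _)) =
          {(e.symm (embed N 0 0), e.symm (embed N 0 1)),
            (e.symm (embed N 0 0), e.symm (embed N 0 4))} := by
        ext ⟨x, y⟩
        simp only [Finset.mem_filter, hA, Finset.mem_singleton, Finset.mem_insert, Prod.mk.injEq]
        constructor
        · rintro ⟨h, rfl, -⟩
          rw [e.apply_symm_apply] at h
          obtain ⟨l, hl, hy⟩ := h.exists_of_tail (by decide)
          have hout : ∀ l : Fin 7, (0, l) ∈ gadgetArcs → l = 1 ∨ l = 4 := by decide
          rcases hout l hl with rfl | rfl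
          · exact .inl ⟨rfl, (e.symm_apply_eq.2 hy.symm).symm⟩
          · exact .inr ⟨rfl, (e.symm_apply_eq.2 hy.symm).symm⟩
        · rintro (⟨rfl, rfl⟩ | ⟨rfl, rfl⟩)
          · refine ⟨?_, rfl, fun h => ?_⟩
            · rw [e.apply_symm_apply, e.apply_symm_apply]
              exact .inr ⟨0, (0, 1), by decide, rfl, rfl⟩
            · exact absurd (embed_injective 0 (e.symm.injective h)) (by decide)
          · refine ⟨?_, rfl, fun h => ?_⟩
            · rw [e.apply_symm_apply, e.apply_symm_apply]
              exact .inr ⟨0, (0, 4), by decide, rfl, rfl⟩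
            · exact absurd (embed_injective 0 (e.symm.injective h)) (by decide)
      rw [cutCard, hcut]
      refine Finset.card_pair fun h => ?_
      exact absurd (embed_injective 0 (e.symm.injective (Prod.mk.inj h).2)) (by decide)
  · intro S hS
    have hinj : Set.InjOn (fun x => color (e x)) (S : Set (Fin _)) := by
      intro x hx y hy hxy
      by_contra hne
      rcases arc_of_color_eq (e.injective.ne hne) hxy with h | h
      · exact (hS x hx y hy hne).1 ((hA _ _).2 h)
      · exact (hS x hx y hy hne).2 ((hA _ _).2 h)
    simpa using Finset.card_le_card_of_injOn (t := Finset.univ) _ (by simp) hinj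
  · rintro ⟨I, O, r, q, ⟨-, hIA, -, hIr, -⟩, ⟨-, hOA, -, hOq, -⟩, hdisj⟩
    have hcopy : ∀ x : Vertex N, ∃ d : Fin 3, ∀ c, c ≠ d → ∀ k : Fin 7, k.val < 5 →
        x ≠ embed N c k := by
      rintro (⟨d, j⟩ | i)
      · refine ⟨d, fun c hc k hk h => hc ?_⟩
        simp [embed, hk] at h
        exact h.1.symm
      · exact ⟨0, fun c _ k hk h => by simp [embed, hk] at h⟩
    obtain ⟨d, hd⟩ := hcopy (e r)
    obtain ⟨d', hd'⟩ := hcopy (e q)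
    have havoid : ∀ d d' : Fin 3, ∃ c, c ≠ d ∧ c ≠ d' := by decide
    obtain ⟨c, hcd, hcd'⟩ := havoid d d'
    refine gadget_obstruction (fun k l => (e.symm (embed N c k), e.symm (embed N c l)) ∈ I)
      (fun k l => (e.symm (embed N c k), e.symm (embed N c l)) ∈ O)
      (fun k l h => Finset.disjoint_left.1 hdisj h) ?_ ?_
    · rintro T ⟨t, ht⟩ hT
      obtain ⟨x, y, hxy, ⟨k, hk, hx⟩, hy⟩ :=
        (hIr (e.symm (embed N c t)) (Finset.mem_univ _)).exists_exit
          (P := fun x => ∃ k ∈ T, e x = embed N c k) ⟨t, ht, e.apply_symm_apply _⟩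
          (fun ⟨k, hk, h⟩ => hd c hcd k (hT k hk) h)
      have h := (hA _ _).1 (hIA hxy)
      rw [hx] at h
      obtain ⟨l, hl, hyl⟩ := h.exists_of_tail (hT k hk)
      refine ⟨k, hk, l, fun hlT => hy ⟨l, hlT, hyl⟩, hl, ?_⟩
      rwa [← hx, ← hyl, e.symm_apply_apply, e.symm_apply_apply]
    · rintro T ⟨t, ht⟩ hT
      obtain ⟨x, y, hxy, hx, hy⟩ :=
        (hOq (e.symm (embed N c t)) (Finset.mem_univ _)).exists_exit
          (P := fun x => ¬ ∃ k ∈ T, e x = embed N c k)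
          (fun ⟨k, hk, h⟩ => hd' c hcd' k (hT k hk) h)
          (not_not.2 ⟨t, ht, e.apply_symm_apply _⟩)
      obtain ⟨l, hl, hyl⟩ := not_not.1 hy
      have h := (hA _ _).1 (hOA hxy)
      rw [hyl] at h
      obtain ⟨k, hk, hxk⟩ := h.exists_of_head (hT l hl)
      refine ⟨k, fun hkT => hx ⟨k, hkT, hxk⟩, l, hl, hk, ?_⟩
      rwa [← hyl, ← hxk, e.symm_apply_apply, e.symm_apply_apply]
end

section
/- Let H₄ be the digraph with vertex set {a₁,…,a₅,b₁,…,b₅} and arc set consisting of the arcs aᵢ→aᵢ₊₁ for i = 1,…,5 (indices modulo 5, so a₅→a₁), the arcs bᵢ₊₁→bᵢ for i = 1,…,5 (indices modulo 5, so b₁→b₅), and the arcs aᵢ→bᵢ and bᵢ→aᵢ for i = 1,…,5. Then the independence number α(H₄) equals 4, the arc-connectivity λ(H₄) equals 2, and H₄ has no good pair. -/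
/-!
Digraphs are modelled by a finite vertex type `V` (with decidable equality) together with
an arc set `A : Finset (V × V)`; irreflexivity (`∀ e ∈ A, e.1 ≠ e.2`) is stated as a
hypothesis.  Subdigraphs on a vertex set `S : Finset V` use arcs with both endpoints in `S`.
-/

variable {V : Type*} [Fintype V] [DecidableEq V]

/-- The digraph `H₄`, with vertices `aᵢ = i - 1` for `i = 1,…,5` and `bᵢ = 4 + i`
for `i = 1,…,5`: the `a`-vertices form a directed 5-cycle, the `b`-vertices form the
reverse directed 5-cycle, and each `aᵢ, bᵢ` is joined by a 2-cycle. -/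
def Hfour : Finset (Fin 10 × Fin 10) :=
  { (0, 1), (1, 2), (2, 3), (3, 4), (4, 0),
    (6, 5), (7, 6), (8, 7), (9, 8), (5, 9),
    (0, 5), (5, 0), (1, 6), (6, 1), (2, 7), (7, 2), (3, 8), (8, 3), (4, 9), (9, 4) }

/-- The bit mask `S`, viewed as a vertex set of `H₄`, moved across the 2-cycles. -/
def partnerMask (S : ℕ) : ℕ := (S >>> 5) ||| ((S &&& 31) <<< 5)

/-- The bit mask `S` moved one step forward along the two 5-cycles of `H₄`. -/
def cycleSuccMask (S : ℕ) : ℕ :=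
  ((S &&& 15) <<< 1) ||| ((S &&& 16) >>> 4) ||| ((S &&& 960) >>> 1) ||| ((S &&& 32) <<< 4)

/-- The bit mask `S` moved one step backward along the two 5-cycles of `H₄`. -/
def cyclePredMask (S : ℕ) : ℕ :=
  ((S &&& 30) >>> 1) ||| ((S &&& 1) <<< 4) ||| ((S &&& 480) <<< 1) ||| ((S &&& 512) >>> 4)

/-- The bit mask `m` selects one arc out of each vertex `v` of `H₄`: the arc to its partner
`v + 5` if bit `v` is set, and the arc along its 5-cycle otherwise. -/
def selected (m : ℕ) (e : Fin 10 × Fin 10) : Bool :=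
  m.testBit e.1.val == decide (e.2 = e.1 + 5)

/-- Add to the vertex set `S` the tails of the selected arcs with head in `S`. -/
def selectedStep (m S : ℕ) : ℕ :=
  S ||| (partnerMask S &&& m) ||| (cyclePredMask S &&& (1023 ^^^ m))

/-- Add to the vertex set `S` the heads of the arcs with tail in `S` that are not selected
or leave vertex `0`. -/
def remainingStep (m S : ℕ) : ℕ :=
  S ||| partnerMask (S &&& ((1023 ^^^ m) ||| 1)) |||
    cycleSuccMask (S &&& (m ||| 1))

/-- The bit mask `S` contains `s`, omits some vertex, and is fixed by `step`. -/
def isSeparator (step : ℕ → ℕ) (s : Fin 10) (S : ℕ) : Bool :=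
  !(S &&& 1023).beq 1023 && S.testBit s.val && (step S).beq S

/-- Iterating `step` from `s` certifies that some vertex is unreachable from `s`. -/
def unreachable (step : ℕ → ℕ) (s : Fin 10) : Bool :=
  isSeparator step s (step^[7] (2 ^ s.val))

theorem exists_not_reach_of_unreachable {R : Fin 10 → Fin 10 → Prop} {step : ℕ → ℕ}
    {s : Fin 10}
    (hstep : ∀ S u v, R u v → S.testBit u.val = true → (step S).testBit v.val = true)
    (h : unreachable step s = true) : ∃ v, ¬ Relation.ReflTransGen R s v := by
  unfold unreachable at h
  generalize step^[7] (2 ^ s.val) = S at h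
  simp only [isSeparator, Bool.and_eq_true, Bool.not_eq_true', Nat.beq_eq] at h
  obtain ⟨⟨hne, hs⟩, hfix⟩ := h
  by_contra! hall
  have hS : ∀ v : Fin 10, S.testBit v.val = true := fun v => by
    induction hall v with
    | refl => exact hs
    | tail _ he ih => exact hfix ▸ hstep S _ _ he ih
  have : S &&& 1023 = 1023 := by
    refine Nat.eq_of_testBit_eq fun i => ?_
    rw [Nat.testBit_land, show 1023 = 2 ^ 10 - 1 from rfl, Nat.testBit_two_pow_sub_one]
    by_cases hi : i < 10
    · simp [hi, hS ⟨i, hi⟩]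
    · simp [hi]
  simp [this] at hne

theorem testBit_selectedStep {m S : ℕ} {u v : Fin 10} (he : (u, v) ∈ Hfour)
    (hsel : selected m (u, v) = true) (hS : S.testBit v.val = true) :
    (selectedStep m S).testBit u.val = true := by
  simp only [Hfour, Finset.mem_insert, Finset.mem_singleton, Prod.mk.injEq] at he
  rcases he with h | h | h | h | h | h | h | h | h | h | h | h | h | h | h | h | h | h | h | h <;>
    obtain ⟨rfl, rfl⟩ := h <;>
    simp_all [selected, selectedStep, partnerMask, cyclePredMask, -Nat.testBit_zero,
      Nat.testBit_xor, Nat.testBit_shiftLeft, Nat.testBit_shiftRight] <;>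
    simp_all [Nat.testBit_eq_decide_div_mod_eq]

theorem testBit_remainingStep {m S : ℕ} {u v : Fin 10} (he : (u, v) ∈ Hfour)
    (hsel : u = 0 ∨ selected m (u, v) = false) (hS : S.testBit u.val = true) :
    (remainingStep m S).testBit v.val = true := by
  simp only [Hfour, Finset.mem_insert, Finset.mem_singleton, Prod.mk.injEq] at he
  rcases he with h | h | h | h | h | h | h | h | h | h | h | h | h | h | h | h | h | h | h | h <;>
    obtain ⟨rfl, rfl⟩ := h <;>
    simp_all [selected, remainingStep, partnerMask, cycleSuccMask, -Nat.testBit_zero,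
      Nat.testBit_xor, Nat.testBit_shiftLeft, Nat.testBit_shiftRight] <;>
    simp_all [Nat.testBit_eq_decide_div_mod_eq]

theorem unreachable_selectedStep_or_remainingStep :
    ∀ m < 2 ^ 10, (unreachable (selectedStep m) 0 ||
      (List.finRange 10).all (unreachable (remainingStep m))) = true := by
  have h : (List.range (2 ^ 10)).all (fun m => unreachable (selectedStep m) 0 ||
      (List.finRange 10).all (unreachable (remainingStep m))) = true := by
    decide +kernel
  exact fun m hm => List.all_eq_true.mp h m (List.mem_range.mpr hm)

theorem eq_of_mem_Hfour_of_ne_partner {u v w : Fin 10} (hv : (u, v) ∈ Hfour)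
    (hw : (u, w) ∈ Hfour) (hv' : v ≠ u + 5) (hw' : w ≠ u + 5) : v = w := by
  fin_cases u <;> simp_all [Hfour]

/-- The automorphism of `H₄` rotating both 5-cycles. -/
def hfourRotation : Equiv.Perm (Fin 10) := c[0, 1, 2, 3, 4] * c[5, 6, 7, 8, 9]

/-- The automorphism of `H₄` exchanging its two 5-cycles. -/
def hfourExchange : Equiv.Perm (Fin 10) := c[0, 5] * c[1, 9] * c[2, 8] * c[3, 7] * c[4, 6]

theorem pow_mem_Hfour_iff {σ : Equiv.Perm (Fin 10)}
    (hσ : ∀ u v, (σ u, σ v) ∈ Hfour ↔ (u, v) ∈ Hfour) (n : ℕ) (u v : Fin 10) :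
    ((σ ^ n) u, (σ ^ n) v) ∈ Hfour ↔ (u, v) ∈ Hfour := by
  induction n with
  | zero => simp
  | succ n ih => rw [pow_succ', Equiv.Perm.mul_apply, Equiv.Perm.mul_apply, hσ, ih]

theorem exists_automorphism (r : Fin 10) : ∃ σ : Equiv.Perm (Fin 10), σ 0 = r ∧
    ∀ u v, (σ u, σ v) ∈ Hfour ↔ (u, v) ∈ Hfour := by
  refine ⟨hfourRotation ^ r.val * hfourExchange ^ (r.val / 5), ?_, fun u v => ?_⟩
  · revert r
    decide +kernel
  · rw [Equiv.Perm.mul_apply, Equiv.Perm.mul_apply, pow_mem_Hfour_iff (by decide +kernel),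
      pow_mem_Hfour_iff (by decide +kernel)]

theorem exists_selection {I : Finset (Fin 10 × Fin 10)} {σ : Equiv.Perm (Fin 10)}
    (hI : I ⊆ Hfour) (hσ : ∀ u v, (σ u, σ v) ∈ Hfour ↔ (u, v) ∈ Hfour)
    (hdeg : ∀ v, v ≠ σ 0 → (I.filter (fun e => e.1 = v)).card = 1) :
    ∃ m < 2 ^ 10, ∀ u v, (u, v) ∈ Hfour → u ≠ 0 →
      ((σ u, σ v) ∈ I ↔ selected m (u, v) = true) := by
  refine ⟨Nat.ofBits fun v : Fin 10 => decide ((σ v, σ (v + 5)) ∈ I),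
    Nat.ofBits_lt_two_pow _, fun u w he hu => ?_⟩
  obtain ⟨f, hf⟩ := Finset.card_eq_one.mp (hdeg (σ u) (σ.injective.ne hu))
  have hmem : ∀ x, (σ u, σ x) ∈ I ↔ (σ u, σ x) = f := fun x => by
    simpa using Finset.ext_iff.mp hf (σ u, σ x)
  have hf' : f ∈ I ∧ f.1 = σ u := by simpa using Finset.ext_iff.mp hf f
  obtain ⟨x, rfl⟩ : ∃ x, f = (σ u, σ x) :=
    ⟨σ.symm f.2, Prod.ext hf'.2 (σ.apply_symm_apply _).symm⟩
  have hx : (u, x) ∈ Hfour := (hσ u x).mp (hI hf'.1)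
  simp only [selected, Nat.testBit_ofBits_lt _ _ u.isLt, Fin.eta, beq_iff_eq, decide_eq_decide,
    hmem, Prod.mk.injEq, true_and, σ.injective.eq_iff]
  by_cases hw : w = u + 5
  · simp [hw]
  · simp only [hw, iff_false]
    refine ⟨fun h h' => hw (h.trans h'.symm), fun h => ?_⟩
    exact eq_of_mem_Hfour_of_ne_partner he hx hw (Ne.symm h)

theorem not_goodPair_Hfour : ¬ GoodPair Finset.univ Hfour := by
  rintro ⟨I, O, r, q, ⟨-, hIA, -, hIr, hIdeg⟩, ⟨-, hOA, -, hOr, -⟩, hdisj⟩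
  obtain ⟨σ, rfl, hσ⟩ := exists_automorphism r
  obtain ⟨q, rfl⟩ := σ.surjective q
  obtain ⟨m, hm, hsel⟩ := exists_selection hIA hσ fun v => hIdeg v (Finset.mem_univ v)
  have hlift : ∀ {B : Finset (Fin 10 × Fin 10)} {u v}, Reach B (σ u) (σ v) →
      Relation.ReflTransGen (fun x y => (σ x, σ y) ∈ B) u v := fun {B u v} h => by
    simpa [Function.onFun] using Relation.ReflTransGen.lift (p := fun x y => (σ x, σ y) ∈ B) σ.symm
      (fun a b hab => by simpa [Function.onFun] using hab) _ _ h
  rcases (Bool.or_eq_true _ _).mp (unreachable_selectedStep_or_remainingStep m hm) with h | h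
  · obtain ⟨v, hv⟩ := exists_not_reach_of_unreachable
      (R := fun x y => (y, x) ∈ Hfour ∧ selected m (y, x) = true)
      (fun S u v huv => testBit_selectedStep huv.1 huv.2) h
    refine hv (Relation.ReflTransGen.head_induction_on
      (motive := fun a _ => Relation.ReflTransGen _ 0 a)
      (hlift (hIr (σ v) (Finset.mem_univ _))) .refl fun {a c} hac _ ih => ?_)
    by_cases ha : a = 0
    · exact ha ▸ .refl
    · have hA := (hσ a c).mp (hIA hac)
      exact ih.tail ⟨hA, (hsel a c hA ha).mp hac⟩
  · obtain ⟨v, hv⟩ := exists_not_reach_of_unreachable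
      (R := fun x y => (x, y) ∈ Hfour ∧ (x = 0 ∨ selected m (x, y) = false))
      (fun S u v huv => testBit_remainingStep huv.1 huv.2)
      (List.all_eq_true.mp h q (List.mem_finRange q))
    refine hv (Relation.ReflTransGen.mono (fun a c hac => ?_) _ _
      (hlift (hOr (σ v) (Finset.mem_univ _))))
    have hA := (hσ a c).mp (hOA hac)
    refine ⟨hA, or_iff_not_imp_left.mpr fun ha => ?_⟩
    simpa [hsel a c hA ha] using Finset.disjoint_right.mp hdisj hac

theorem indepNumEq_Hfour : IndepNumEq Hfour 4 := by
  refine ⟨fun S hS => ?_, {0, 2, 6, 8}, by unfold IsIndep; decide +kernel, by decide⟩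
  have hcard : S.card = ∑ v : Fin 10, if v ∈ S then 1 else 0 := by simp
  have hedge : ∀ u v, (u, v) ∈ Hfour → u ≠ v →
      (if u ∈ S then 1 else 0) + (if v ∈ S then 1 else 0) ≤ 1 := fun u v he hne => by
    by_cases hu : u ∈ S <;> by_cases hv : v ∈ S <;> simp [hu, hv]
    exact (hS u hu v hv hne).1 he
  have h01 := hedge 0 1 (by decide) (by decide)
  have h12 := hedge 1 2 (by decide) (by decide)
  have h23 := hedge 2 3 (by decide) (by decide)
  have h34 := hedge 3 4 (by decide) (by decide)
  have h40 := hedge 4 0 (by decide) (by decide)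
  have h65 := hedge 6 5 (by decide) (by decide)
  have h76 := hedge 7 6 (by decide) (by decide)
  have h87 := hedge 8 7 (by decide) (by decide)
  have h98 := hedge 9 8 (by decide) (by decide)
  have h59 := hedge 5 9 (by decide) (by decide)
  rw [hcard]
  simp only [Fin.sum_univ_succ, Fin.sum_univ_zero, Fin.reduceSucc, Fin.succ_zero_eq_one]
  omega

theorem two_le_sum_cut_Hfour : ∀ b₀ b₁ b₂ b₃ b₄ b₅ b₆ b₇ b₈ b₉ : Bool,
    (b₀ || b₁ || b₂ || b₃ || b₄ || b₅ || b₆ || b₇ || b₈ || b₉) = true →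
    (b₀ && b₁ && b₂ && b₃ && b₄ && b₅ && b₆ && b₇ && b₈ && b₉) = false →
    2 ≤ (b₀ && !b₁).toNat + (b₁ && !b₂).toNat + (b₂ && !b₃).toNat + (b₃ && !b₄).toNat +
      (b₄ && !b₀).toNat + (b₆ && !b₅).toNat + (b₇ && !b₆).toNat + (b₈ && !b₇).toNat +
      (b₉ && !b₈).toNat + (b₅ && !b₉).toNat + (b₀ && !b₅).toNat + (b₅ && !b₀).toNat +
      (b₁ && !b₆).toNat + (b₆ && !b₁).toNat + (b₂ && !b₇).toNat + (b₇ && !b₂).toNat +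
      (b₃ && !b₈).toNat + (b₈ && !b₃).toNat + (b₄ && !b₉).toNat + (b₉ && !b₄).toNat := by
  decide +kernel

theorem arcConnEq_Hfour : ArcConnEq Hfour 2 := by
  refine ⟨fun X hne huniv => ?_, {0}, by decide, by decide, by decide +kernel⟩
  have hcut : cutCard Hfour X =
      ∑ e ∈ Hfour, (decide (e.1 ∈ X) && !decide (e.2 ∈ X)).toNat := by
    rw [cutCard, Finset.card_filter]
    refine Finset.sum_congr rfl fun e _ => ?_
    by_cases h₁ : e.1 ∈ X <;> by_cases h₂ : e.2 ∈ X <;> simp [h₁, h₂]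
  have h := two_le_sum_cut_Hfour (decide (0 ∈ X)) (decide (1 ∈ X)) (decide (2 ∈ X))
    (decide (3 ∈ X)) (decide (4 ∈ X)) (decide (5 ∈ X)) (decide (6 ∈ X)) (decide (7 ∈ X))
    (decide (8 ∈ X)) (decide (9 ∈ X)) ?_ ?_
  · rw [hcut]
    simpa [Hfour, add_assoc] using h
  · obtain ⟨v, hv⟩ := hne
    fin_cases v <;> simp_all
  · obtain ⟨v, hv⟩ : ∃ v, v ∉ X := by
      by_contra! hall
      exact huniv (Finset.eq_univ_iff_forall.mpr hall)
    fin_cases v <;> simp_all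

/-- `H₄` has independence number 4, arc-connectivity 2, and no good pair. -/
theorem stmt18 :
    IndepNumEq Hfour 4 ∧ ArcConnEq Hfour 2 ∧ ¬ GoodPair Finset.univ Hfour := by
  exact ⟨indepNumEq_Hfour, arcConnEq_Hfour, not_goodPair_Hfour⟩
end

section
/- Every digraph on exactly 6 vertices with arc-connectivity λ(D) ≥ 2 has a good pair. -/
/-!
Digraphs are modelled by a finite vertex type `V` (with decidable equality) together with
an arc set `A : Finset (V × V)`; irreflexivity (`∀ e ∈ A, e.1 ≠ e.2`) is stated as a
hypothesis.  Subdigraphs on a vertex set `S : Finset V` use arcs with both endpoints in `S`.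
-/

variable {V : Type*} [Fintype V] [DecidableEq V]

/-- The arcs `(i, j)` on the vertices `0, …, 5` are coded by `6 * i + j`, and sets of arcs by
bit masks. The mask of all arcs with tail `i`. -/
def rowMask (i : ℕ) : ℕ := 63 <<< (6 * i)

/-- The mask of all arcs with head `j`. -/
def colMask (j : ℕ) : ℕ := 1090785345 <<< j

/-- `f n`, arranged so that the kernel evaluates `n` before substituting it. -/
def withValue {α : Type} (n : ℕ) (f : ℕ → α) : α :=
  Nat.casesOn n (f 0) fun k => f (Nat.succ k)

/-- At most one bit of `x` is set. -/
def atMostOneBit (x : ℕ) : Bool := Nat.beq (x &&& (x - 1)) 0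

/-- The mask of all arcs leaving the vertex set with mask `X`. -/
def cutMask (X : ℕ) : ℕ :=
  (List.range 6).foldr (fun i m => if X.testBit i then m ||| rowMask i else m) 0 &&&
    (List.range 6).foldr (fun i m => if X.testBit i then m else m ||| colMask i) 0

/-- The mask of all arcs between distinct vertices. -/
def completeMask : ℕ := 34089189246

/-- Looks for a vertex set left by at most one arc of `U`; `0` stands for failure. -/
def findCut (U : ℕ) : List ℕ → ℕ → ℕ → ℕ → ℕ
  | [], X, R, C => if atMostOneBit (U &&& R &&& C) && !Nat.beq X 63 then X else 0
  | i :: l, X, R, C =>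
    if atMostOneBit (U &&& R &&& C) then
      match withValue (R ||| rowMask i) fun R' => findCut U l (X + 1 <<< i) R' C with
      | 0 => withValue (C ||| colMask i) fun C' => findCut U l X R C'
      | Y + 1 => Y + 1
    else 0

/-- Greedily grows a tree with vertices `T` and arcs `t` along arcs of `W`, where `code u v` codes
the arc that attaches `v` to `u`. The result lists the arcs in the order in which they are added. -/
def growTree (code : ℕ → ℕ → ℕ) (W : ℕ) :
    ℕ → List ℕ → List ℕ → List ℕ → List ℕ → Option (List ℕ)
  | 0, _, _, _, _ => none
  | _ + 1, [], [], _, t => some t.reverse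
  | _ + 1, _ :: _, [], _, _ => none
  | n + 1, s, v :: r, T, t =>
    match T.find? fun u => W.testBit (code u v) with
    | none => growTree code W n (s ++ [v]) r T t
    | some u => growTree code W n [] (s ++ r) (v :: T) (code u v :: t)

/-- Tries all roots for `growTree`. -/
def findTree (code : ℕ → ℕ → ℕ) (W : ℕ) : List ℕ → Option (ℕ × List ℕ)
  | [] => none
  | q :: l =>
    match growTree code W 22 [] ([0, 1, 2, 3, 4, 5].filter fun v => !Nat.beq v q) [q] [] with
    | some t => some (q, t)
    | none => findTree code W l

/-- What a node of the search can be closed with: a small cut, a relabelling that makes a longer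
path standard, or a good pair (with roots, and arcs in growth order). -/
inductive Witness where
  | cut (X : ℕ)
  | path (p : List ℕ)
  | pair (r q : ℕ) (I O : List ℕ)

/-- Backtracking search for a directed path with a prescribed number of vertices in `U`. -/
def findPath (goal : List ℕ → List ℕ → Option Witness) (U : ℕ) :
    ℕ → ℕ → List ℕ → List ℕ → List ℕ → Option Witness
  | 0, _, _, _, _ => none
  | _ + 1, 0, p, s, r => goal p (s ++ r)
  | _ + 1, _ + 1, _, _, [] => none
  | n + 1, k + 1, p, s, v :: r =>
    if (match p with | [] => true | u :: _ => U.testBit (6 * v + u)) then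
      match findPath goal U n k (v :: p) [] (s ++ r) with
      | some w => some w
      | none => findPath goal U n (k + 1) p (s ++ [v]) r
    else findPath goal U n (k + 1) p (s ++ [v]) r

/-- The codes of the first `k` arcs of the path `p`. -/
def pathArcs : ℕ → List ℕ → List ℕ
  | k + 1, u :: v :: p => (6 * u + v) :: pathArcs k (v :: p)
  | _, _ => []

/-- Removes the arc `e` from the mask `U`. -/
def removeArc (U e : ℕ) : ℕ := U ^^^ (U &&& 1 <<< e)

/-- Completes a Hamiltonian path of `U` to a good pair. -/
def completePath (U : ℕ) (p : List ℕ) : Option Witness :=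
  let a := pathArcs 5 p
  withValue (a.foldl removeArc U) fun W =>
    match findTree (fun u v => 6 * v + u) W [0, 1, 2, 3, 4, 5] with
    | some (r, t) => some (.pair r p.head! t a)
    | none =>
      match findTree (fun u v => 6 * u + v) W [0, 1, 2, 3, 4, 5] with
      | some (q, t) => some (.pair p.getLast! q a.reverse t)
      | none => none

/-- Looks for a vertex with at most one arc of `U` leaving or entering it, and returns the set
with at most one leaving arc; `0` stands for failure. -/
def findDegreeCut (U : ℕ) : List ℕ → ℕ
  | [] => 0
  | i :: l =>
    if atMostOneBit (U &&& rowMask i) then 1 <<< i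
    else if atMostOneBit (U &&& colMask i) then 63 - 1 <<< i
    else findDegreeCut U l

/-- Chooses a witness at a node of the search. The explicit pair is tried when no path of `U` can
be used and no small cut is found. -/
def findWitness (k U : ℕ) : Witness :=
  match findDegreeCut U [0, 1, 2, 3, 4, 5] with
  | X + 1 => .cut (X + 1)
  | 0 =>
    match findPath (fun p s => if Nat.ble k 4 then some (.path (p ++ s)) else completePath U p)
        U 40 (min (k + 2) 6) [] [] [5, 4, 3, 2, 1, 0] with
    | some w => w
    | none =>
      match findCut U [0, 1, 2, 3, 4, 5] 0 0 0 with
      | X + 1 => .cut (X + 1)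
      | 0 => .pair 0 0 [6, 25, 31, 13, 20] [1, 8, 15, 22, 11]

/-- The arcs in `l`, added one at a time, span all vertices starting from those in `T`. -/
def spans (old new : ℕ → ℕ) : ℕ → List ℕ → Bool
  | T, [] => Nat.beq T 63
  | T, e :: l => T.testBit (old e) && !T.testBit (new e) &&
    withValue (T ||| 1 <<< new e) fun T' => spans old new T' l

/-- Decision tree: which arcs of the list `l` are present? -/
def branch (next : ℕ → ℕ → Bool) : List ℕ → ℕ → ℕ → Bool
  | [], _, _ => true
  | e :: l, P, U =>
    if P.testBit e then branch next l P U
    else withValue (removeArc U e) (fun U' => next P U') &&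
      withValue (P ||| 1 <<< e) (fun P' => branch next l P' U)

/-- Checks that every digraph between `P` and `U` either has a small cut, or a good pair, or a
path with `k + 1` arcs. -/
def search (k : ℕ) : ℕ → ℕ → ℕ → Bool
  | 0, _, _ => false
  | n + 1, P, U =>
    match findWitness k U with
    | .cut X => Nat.blt 0 X && Nat.blt X 63 && atMostOneBit (U &&& cutMask X)
    | .path p =>
      Nat.ble k 4 && Nat.beq p.length 6 && p.all (fun v => Nat.blt v 6) && decide p.Nodup &&
        branch (search k n) (pathArcs (k + 1) p).reverse P U
    | .pair r q I O =>
      spans (· % 6) (· / 6) (1 <<< r) I && spans (· / 6) (· % 6) (1 <<< q) O &&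
        O.all completeMask.testBit &&
        withValue (O.foldl removeArc completeMask) (fun W => I.all W.testBit) &&
        branch (search k n) (O ++ I) P U

/-- The mask of the arcs of the path `0 → 1 → ⋯ → k`. -/
def startPath (k : ℕ) : ℕ :=
  (pathArcs k [0, 1, 2, 3, 4, 5]).foldl (fun m e => m ||| 1 <<< e) 0

section Soundness

theorem withValue_eq {α : Type} (n : ℕ) (f : ℕ → α) : withValue n f = f n := by
  cases n <;> rfl

theorem testBit_or_shift (T n i : ℕ) :
    (T ||| 1 <<< n).testBit i = true ↔ T.testBit i = true ∨ n = i := by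
  simp [Nat.one_shiftLeft, Nat.testBit_two_pow]

theorem testBit_removeArc (U e i : ℕ) :
    (removeArc U e).testBit i = true ↔ U.testBit i = true ∧ i ≠ e := by
  unfold removeArc
  simp only [Nat.one_shiftLeft, Nat.testBit_xor, Nat.testBit_and, Nat.testBit_two_pow]
  by_cases h : e = i <;> cases U.testBit i <;> simp [h, eq_comm]

theorem testBit_foldl_removeArc (l : List ℕ) (U i : ℕ) :
    (l.foldl removeArc U).testBit i = true ↔ U.testBit i = true ∧ i ∉ l := by
  induction l generalizing U with
  | nil => simp
  | cons e l ih => simp [ih, testBit_removeArc, and_assoc]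

theorem eq_of_atMostOneBit {x a b : ℕ} (h : atMostOneBit x = true) (ha : x.testBit a = true)
    (hb : x.testBit b = true) : a = b := by
  have hx : x ≠ 0 := by rintro rfl; simp at ha
  obtain ⟨k, rfl⟩ :=
    (Nat.and_sub_one_eq_zero_iff_isPowerOfTwo hx).1 (Nat.eq_of_beq_eq_true h)
  simp only [Nat.testBit_two_pow, decide_eq_true_eq] at ha hb
  exact ha.symm.trans hb

theorem lt_of_testBit_completeMask {e : ℕ} (h : completeMask.testBit e = true) : e < 36 := by
  by_contra he
  rw [Nat.testBit_lt_two_pow] at h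
  · simp at h
  · exact lt_of_lt_of_le (by decide : completeMask < 2 ^ 36)
      (Nat.pow_le_pow_right (by norm_num) (not_lt.1 he))

theorem testBit_completeMask : ∀ e < 36, e / 6 ≠ e % 6 → completeMask.testBit e = true := by
  decide

theorem testBit_cutMask : ∀ X < 63, ∀ e < 36, X.testBit (e / 6) = true →
    X.testBit (e % 6) = false → (cutMask X).testBit e = true := by
  decide +kernel

theorem spans_reach {α : Type*} {old new : ℕ → ℕ} {g : ℕ → α} {R : α → α → Prop} {x : α} :
    ∀ {l : List ℕ} {T : ℕ}, spans old new T l = true →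
      (∀ e ∈ l, R (g (old e)) (g (new e))) →
      (∀ i, T.testBit i = true → Relation.ReflTransGen R x (g i)) →
      ∀ i < 6, Relation.ReflTransGen R x (g i)
  | [], T, h, _, hT, i, hi => by
    obtain rfl := Nat.eq_of_beq_eq_true h
    exact hT i (by interval_cases i <;> rfl)
  | e :: l, T, h, hl, hT, i, hi => by
    simp only [spans, withValue_eq, Bool.and_eq_true] at h
    refine spans_reach h.2 (fun e' he' => hl e' (List.mem_cons_of_mem _ he')) (fun j hj => ?_) i hi
    obtain hj | rfl := (testBit_or_shift _ _ _).1 hj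
    · exact hT j hj
    · exact (hT _ h.1.1).tail (hl e List.mem_cons_self)

theorem spans_unique {old new : ℕ → ℕ} {i : ℕ} (hi : i < 6) :
    ∀ {l : List ℕ} {T : ℕ}, spans old new T l = true →
      (T.testBit i = true → ∀ e ∈ l, new e ≠ i) ∧
        (T.testBit i = false → ∃ e ∈ l, ∀ e' ∈ l, new e' = i ↔ e' = e)
  | [], T, h => by
    obtain rfl := Nat.eq_of_beq_eq_true h
    refine ⟨by simp, fun h => absurd h ?_⟩
    interval_cases i <;> decide
  | e :: l, T, h => by
    simp only [spans, withValue_eq, Bool.and_eq_true, Bool.not_eq_true'] at h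
    obtain ⟨⟨-, hnew⟩, h⟩ := h
    obtain ⟨h₁, h₂⟩ := spans_unique hi h
    rw [testBit_or_shift] at h₁
    rw [← Bool.not_eq_true, testBit_or_shift, not_or] at h₂
    refine ⟨fun hT => ?_, fun hT => ?_⟩
    · rintro e' (_ | ⟨_, he'⟩)
      · rintro rfl; simp [hT] at hnew
      · exact h₁ (.inl hT) _ he'
    · by_cases hei : new e = i
      · have hl := h₁ (.inr hei)
        have : e ∉ l := fun he => hl e he hei
        refine ⟨e, List.mem_cons_self, ?_⟩
        rintro e' (_ | ⟨_, he'⟩)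
        · simp [hei]
        · exact iff_of_false (hl _ he') (by rintro rfl; exact this he')
      · obtain ⟨a, ha, hal⟩ := h₂ ⟨by simp [hT], hei⟩
        refine ⟨a, List.mem_cons_of_mem _ ha, ?_⟩
        rintro e' (_ | ⟨_, he'⟩)
        · refine iff_of_false hei ?_
          rintro rfl
          exact hei ((hal _ ha).2 rfl)
        · exact hal e' he'

theorem branch_sound {C : Prop} {p : ℕ → Prop} {next : ℕ → ℕ → Bool}
    (hnext : ∀ P U, next P U = true → (∀ e, P.testBit e = true → p e) →
      (∀ e < 36, p e → U.testBit e = true) → C) :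
    ∀ {l : List ℕ} {P U : ℕ}, branch next l P U = true → (∀ e, P.testBit e = true → p e) →
      (∀ e < 36, p e → U.testBit e = true) → ((∀ e ∈ l, p e) → C) → C
  | [], _, _, _, _, _, hC => hC (by simp)
  | e :: l, P, U, h, hP, hU, hC => by
    have hcons (he : p e) (hl : ∀ e' ∈ l, p e') : C := hC (by simpa [he] using hl)
    rw [branch] at h
    split_ifs at h with he
    · exact branch_sound hnext h hP hU (hcons (hP e he))
    · simp only [withValue_eq, Bool.and_eq_true] at h
      by_cases hp : p e
      · refine branch_sound hnext h.2 (fun i hi => ?_) hU (hcons hp)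
        obtain hi | rfl := (testBit_or_shift _ _ _).1 hi
        exacts [hP i hi, hp]
      · refine hnext _ _ h.1 hP fun i hi hpi => (testBit_removeArc _ _ _).2 ⟨hU i hi hpi, ?_⟩
        rintro rfl
        exact hp hpi

/-- The pair of vertices coded by `e` under the labelling `f`. -/
def arcOf {V : Type*} (f : ℕ → V) (e : ℕ) : V × V := (f (e / 6), f (e % 6))

theorem arcOf_mem_of_mem_pathArcs {V : Type*} {A : Finset (V × V)} {f : ℕ → V} :
    ∀ {k : ℕ} {p : List ℕ}, (∀ v ∈ p, v < 6) → (∀ e ∈ pathArcs k p, arcOf f e ∈ A) →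
      ∀ i < k, i + 1 < p.length → (f (p.getD i 0), f (p.getD (i + 1) 0)) ∈ A
  | 0, _, _, _, i, hi, _ => by omega
  | k + 1, [], _, _, i, _, hp => by simp at hp
  | k + 1, [_], _, _, i, _, hp => by simp at hp
  | k + 1, u :: v :: p, hv, h, 0, _, _ => by
    have := h (6 * u + v) (by simp [pathArcs])
    have hv6 := hv v (by simp)
    rwa [arcOf, show (6 * u + v) / 6 = u by omega, show (6 * u + v) % 6 = v by omega] at this
  | k + 1, u :: v :: p, hv, h, i + 1, hi, hp => by
    have := arcOf_mem_of_mem_pathArcs (A := A) (f := f) (k := k) (p := v :: p)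
      (fun w hw => hv w (List.mem_cons_of_mem _ hw))
      (fun e he => h e (by simp [pathArcs, he])) i (by omega) (by simpa using hp)
    simpa using this

theorem arcOf_injOn {V : Type*} {f : ℕ → V} (hf : Set.InjOn f (Set.Iio 6)) {d e : ℕ} (hd : d < 36)
    (he : e < 36) (h : arcOf f d = arcOf f e) : d = e := by
  simp only [arcOf, Prod.mk.injEq] at h
  have h₁ := hf (show d / 6 < 6 by omega) (show e / 6 < 6 by omega) h.1
  have h₂ := hf (show d % 6 < 6 by omega) (show e % 6 < 6 by omega) h.2
  omega

theorem exists_label_eq {V : Type*} [Fintype V] {f : ℕ → V} (hcard : Fintype.card V = 6)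
    (hf : Set.InjOn f (Set.Iio 6)) (v : V) :
    ∃ i < 6, f i = v := by
  have hinj : Function.Injective fun i : Fin 6 => f i := fun i j h =>
    Fin.ext (hf i.2 j.2 h)
  obtain ⟨i, hi⟩ := ((Fintype.bijective_iff_injective_and_card _).2
    ⟨hinj, by simp [hcard]⟩).2 v
  exact ⟨i, i.2, hi⟩

theorem card_filter_arcs_eq_one {V : Type*} [DecidableEq V] {f : ℕ → V} {l : List ℕ} {i : ℕ}
    {π : V × V → V} {c : ℕ → ℕ}
    (hc : ∀ e ∈ l, π (arcOf f e) = f i ↔ c e = i)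
    (h : ∃ e ∈ l, ∀ e' ∈ l, c e' = i ↔ e' = e) :
    ((l.map (arcOf f)).toFinset.filter fun e => π e = f i).card = 1 := by
  obtain ⟨e, he, hel⟩ := h
  refine Finset.card_eq_one.2 ⟨arcOf f e, ?_⟩
  ext x
  simp only [Finset.mem_filter, List.mem_toFinset, List.mem_map, Finset.mem_singleton]
  constructor
  · rintro ⟨⟨d, hd, rfl⟩, hx⟩
    rw [(hel d hd).1 ((hc d hd).1 hx)]
  · rintro rfl
    exact ⟨⟨e, he, rfl⟩, (hc e he).2 ((hel e he).2 rfl)⟩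

variable {V : Type*} [Fintype V] [DecidableEq V] {A : Finset (V × V)} {f : ℕ → V}

theorem exists_two_arcs_of_cut (hcard : Fintype.card V = 6) (hconn : ArcConnAtLeast A 2)
    (hf : Set.InjOn f (Set.Iio 6)) {X : ℕ} (h0 : 0 < X) (h63 : X < 63) :
    ∃ a < 36, ∃ b < 36, a ≠ b ∧ arcOf f a ∈ A ∧ arcOf f b ∈ A ∧
      (cutMask X).testBit a = true ∧ (cutMask X).testBit b = true := by
  have key : ∀ X < 63, 0 < X →
      (∃ i < 6, X.testBit i = true) ∧ ∃ i < 6, X.testBit i = false := by decide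
  obtain ⟨⟨i, hi, hiX⟩, j, hj, hjX⟩ := key X h63 h0
  let S : Finset V := ((Finset.range 6).filter fun i => X.testBit i = true).image f
  have hS {i : ℕ} (hi : i < 6) : f i ∈ S ↔ X.testBit i = true := by
    simp only [S, Finset.mem_image, Finset.mem_filter, Finset.mem_range]
    exact ⟨fun ⟨j, ⟨hj, hjX⟩, hji⟩ => hf hj hi hji ▸ hjX, fun h => ⟨i, ⟨hi, h⟩, rfl⟩⟩
  have hcut := hconn S ⟨f i, (hS hi).2 hiX⟩ fun h => by
    have := (hS hj).1 (h ▸ Finset.mem_univ _)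
    simp [hjX] at this
  have code {e : V × V} (he : e ∈ A.filter fun e => e.1 ∈ S ∧ e.2 ∉ S) :
      ∃ a < 36, arcOf f a = e ∧ e ∈ A ∧ (cutMask X).testBit a = true := by
    obtain ⟨u, v⟩ := e
    obtain ⟨i, hi, rfl⟩ := exists_label_eq hcard hf u
    obtain ⟨j, hj, rfl⟩ := exists_label_eq hcard hf v
    simp only [Finset.mem_filter, hS hi, hS hj] at he
    have hdiv : (6 * i + j) / 6 = i := by omega
    have hmod : (6 * i + j) % 6 = j := by omega
    refine ⟨6 * i + j, by omega, by rw [arcOf, hdiv, hmod], he.1,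
      testBit_cutMask X h63 _ (by omega) ?_ ?_⟩
    · rw [hdiv]; exact he.2.1
    · rw [hmod]; simpa using he.2.2
  obtain ⟨e, he, e', he', hne⟩ := Finset.one_lt_card.1 (Nat.lt_of_succ_le hcut)
  obtain ⟨a, ha, rfl, haA, haX⟩ := code he
  obtain ⟨b, hb, rfl, hbA, hbX⟩ := code he'
  exact ⟨a, ha, b, hb, fun h => hne (h ▸ rfl), haA, hbA, haX, hbX⟩

theorem isOutBranching_of_spans (hcard : Fintype.card V = 6) (hf : Set.InjOn f (Set.Iio 6))
    {q : ℕ} {l : List ℕ} (h : spans (· / 6) (· % 6) (1 <<< q) l = true)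
    (hl : ∀ e ∈ l, arcOf f e ∈ A) :
    IsOutBranching Finset.univ A (l.map (arcOf f)).toFinset (f q) := by
  refine ⟨Finset.mem_univ _, fun x hx => ?_, by simp, fun v _ => ?_, fun v _ hv => ?_⟩
  · obtain ⟨e, he, rfl⟩ := List.mem_map.1 (List.mem_toFinset.1 hx)
    exact hl e he
  · obtain ⟨i, hi, rfl⟩ := exists_label_eq hcard hf v
    refine spans_reach h (fun e he => List.mem_toFinset.2 (List.mem_map_of_mem he))
      (fun j hj => ?_) i hi
    simp only [Nat.one_shiftLeft, Nat.testBit_two_pow, decide_eq_true_eq] at hj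
    rw [hj]
  · obtain ⟨i, hi, rfl⟩ := exists_label_eq hcard hf v
    refine card_filter_arcs_eq_one (c := (· % 6)) (fun e _ => ?_) ((spans_unique hi h).2 ?_)
    · exact ⟨fun he => hf (show e % 6 < 6 by omega) hi he, fun he => congrArg f he⟩
    · simp only [Nat.one_shiftLeft, Nat.testBit_two_pow, decide_eq_false_iff_not]
      rintro rfl
      exact hv rfl

theorem isInBranching_of_spans (hcard : Fintype.card V = 6) (hf : Set.InjOn f (Set.Iio 6))
    {r : ℕ} {l : List ℕ} (h : spans (· % 6) (· / 6) (1 <<< r) l = true)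
    (hl36 : ∀ e ∈ l, e < 36) (hl : ∀ e ∈ l, arcOf f e ∈ A) :
    IsInBranching Finset.univ A (l.map (arcOf f)).toFinset (f r) := by
  refine ⟨Finset.mem_univ _, fun x hx => ?_, by simp, fun v _ => ?_, fun v _ hv => ?_⟩
  · obtain ⟨e, he, rfl⟩ := List.mem_map.1 (List.mem_toFinset.1 hx)
    exact hl e he
  · obtain ⟨i, hi, rfl⟩ := exists_label_eq hcard hf v
    refine Relation.reflTransGen_swap.1 (spans_reach h
      (fun e he => List.mem_toFinset.2 (List.mem_map_of_mem he)) (fun j hj => ?_) i hi)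
    simp only [Nat.one_shiftLeft, Nat.testBit_two_pow, decide_eq_true_eq] at hj
    rw [hj]
  · obtain ⟨i, hi, rfl⟩ := exists_label_eq hcard hf v
    refine card_filter_arcs_eq_one (c := (· / 6)) (fun e he => ?_) ((spans_unique hi h).2 ?_)
    · have := hl36 e he
      exact ⟨fun he => hf (show e / 6 < 6 by omega) hi he, fun he => congrArg f he⟩
    · simp only [Nat.one_shiftLeft, Nat.testBit_two_pow, decide_eq_false_iff_not]
      rintro rfl
      exact hv rfl

/-- Some labelling of the vertices by `0, …, 5` turns `0 → 1 → ⋯ → k` into a path of `A`. -/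
def HasPath (A : Finset (V × V)) (k : ℕ) : Prop :=
  ∃ f : ℕ → V, Set.InjOn f (Set.Iio 6) ∧ ∀ i < k, (f i, f (i + 1)) ∈ A

theorem search_sound (hcard : Fintype.card V = 6) (hconn : ArcConnAtLeast A 2)
    (hf : Set.InjOn f (Set.Iio 6)) {k : ℕ} :
    ∀ n P U, search k n P U = true → (∀ e, P.testBit e = true → arcOf f e ∈ A) →
      (∀ e < 36, arcOf f e ∈ A → U.testBit e = true) →
      GoodPair Finset.univ A ∨ k ≤ 4 ∧ HasPath A (k + 1)
  | 0, _, _, h, _, _ => by simp [search] at h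
  | n + 1, P, U, h, hP, hU => by
    rw [search] at h
    have hnext := search_sound hcard hconn hf (k := k) n
    split at h
    · rename_i X _
      simp only [Bool.and_eq_true, Nat.blt_eq] at h
      obtain ⟨⟨h0, h63⟩, h1⟩ := h
      obtain ⟨a, ha, b, hb, hab, haA, hbA, haX, hbX⟩ :=
        exists_two_arcs_of_cut hcard hconn hf h0 h63
      refine absurd (eq_of_atMostOneBit h1 ?_ ?_) hab
      · rw [Nat.testBit_and, hU a ha haA, haX]; rfl
      · rw [Nat.testBit_and, hU b hb hbA, hbX]; rfl
    · rename_i p _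
      simp only [Bool.and_eq_true, Nat.ble_eq, List.all_eq_true, Nat.blt_eq, decide_eq_true_eq,
        Nat.beq_eq] at h
      obtain ⟨⟨⟨⟨hk, hlen⟩, hlt⟩, hnd⟩, hb⟩ := h
      refine branch_sound hnext hb hP hU fun harcs => .inr ⟨hk, fun i => f (p.getD i 0), ?_, ?_⟩
      · intro i hi j hj hij
        simp only [Set.mem_Iio] at hi hj
        have hi' : i < p.length := by omega
        have hj' : j < p.length := by omega
        simp only [List.getD_eq_getElem _ _ hi', List.getD_eq_getElem _ _ hj'] at hij
        exact (hnd.getElem_inj_iff).1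
          (hf (hlt _ (List.getElem_mem hi')) (hlt _ (List.getElem_mem hj')) hij)
      · intro i hi
        exact arcOf_mem_of_mem_pathArcs hlt (fun e he => harcs e (List.mem_reverse.2 he)) i hi
          (by omega)
    · rename_i r q I O _
      simp only [Bool.and_eq_true, List.all_eq_true, withValue_eq, testBit_foldl_removeArc] at h
      obtain ⟨⟨⟨⟨hI, hO⟩, hO36⟩, hdisj⟩, hb⟩ := h
      refine branch_sound hnext hb hP hU fun harcs => .inl ⟨_, _, f r, f q,
        isInBranching_of_spans hcard hf hI (fun e he => lt_of_testBit_completeMask (hdisj e he).1)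
          (fun e he => harcs e (by simp [he])),
        isOutBranching_of_spans hcard hf hO (fun e he => harcs e (by simp [he])), ?_⟩
      rw [Finset.disjoint_left]
      intro x hx hx'
      obtain ⟨d, hd, rfl⟩ := List.mem_map.1 (List.mem_toFinset.1 hx)
      obtain ⟨e, he, hed⟩ := List.mem_map.1 (List.mem_toFinset.1 hx')
      obtain rfl := arcOf_injOn hf (lt_of_testBit_completeMask (hO36 e he))
        (lt_of_testBit_completeMask (hdisj d hd).1) hed
      exact (hdisj _ hd).2 he

end Soundness

theorem testBit_startPath : ∀ k < 6, startPath k < 2 ^ 36 ∧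
    ∀ e < 36, (startPath k).testBit e = true → e / 6 < k ∧ e % 6 = e / 6 + 1 := by
  decide

set_option maxRecDepth 100000 in
theorem search_startPath : ∀ k < 6, search k 40 (startPath k) completeMask = true := by
  decide +kernel

theorem goodPair_or_hasPath_succ {V : Type*} [Fintype V] [DecidableEq V] {A : Finset (V × V)}
    (hirr : ∀ e ∈ A, e.1 ≠ e.2) (hcard : Fintype.card V = 6) (hconn : ArcConnAtLeast A 2)
    {k : ℕ} (hk : k < 6) (h : HasPath A k) :
    GoodPair Finset.univ A ∨ k ≤ 4 ∧ HasPath A (k + 1) := by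
  obtain ⟨f, hf, hpath⟩ := h
  obtain ⟨hlt, hbit⟩ := testBit_startPath k hk
  refine search_sound hcard hconn hf _ _ _ (search_startPath k hk) (fun e he => ?_)
    fun e he heA => testBit_completeMask e he fun h => hirr _ heA (congrArg f h)
  have he36 : e < 36 := by
    by_contra h36
    rw [Nat.testBit_lt_two_pow (hlt.trans_le (Nat.pow_le_pow_right (by norm_num) (not_lt.1 h36)))]
      at he
    simp at he
  obtain ⟨h₁, h₂⟩ := hbit e he36 he
  rw [arcOf, h₂]
  exact hpath _ h₁

/-- Every digraph on exactly 6 vertices with arc-connectivity at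
least 2 has a good pair. -/
theorem stmt19 {V : Type*} [Fintype V] [DecidableEq V]
    (A : Finset (V × V)) (hirr : ∀ e ∈ A, e.1 ≠ e.2)
    (hcard : Fintype.card V = 6) (hconn : ArcConnAtLeast A 2) :
    GoodPair Finset.univ A := by
  have hpath : ∀ k ≤ 5, GoodPair Finset.univ A ∨ HasPath A k := by
    intro k
    induction k with
    | zero =>
      intro _
      obtain ⟨σ⟩ := Fintype.truncEquivOfCardEq (α := Fin 6) (β := V) (by simp [hcard])
      refine .inr ⟨fun i => σ (Fin.ofNat 6 i), fun i hi j hj hij => ?_, by simp⟩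
      simpa [Fin.ext_iff, Nat.mod_eq_of_lt hi, Nat.mod_eq_of_lt hj] using hij
    | succ k ih =>
      intro hk
      obtain h | h := ih (by omega)
      · exact .inl h
      · exact (goodPair_or_hasPath_succ hirr hcard hconn (by omega) h).imp_right And.right
  obtain h | h := hpath 5 le_rfl
  · exact h
  · obtain h | ⟨h, -⟩ := goodPair_or_hasPath_succ hirr hcard hconn (by norm_num) h
    · exact h
    · omega
end
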